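/- arXiv:1411.3359 — 8 statements merged into one kernel-verified Lean document; each statement's English description precedes it below -/
import Mathlib

section
/- There exist constants λ₁ > 0 and η₁ > 0 such that μ(B(x,ε)) ≤ λ₁ ε^{η₁} for every x ∈ ℝ^q and every ε > 0, where B(x,ε) denotes the closed ball of radius ε centered at x. -/
open MeasureTheory Metric

/-- `A` has diameter at most `r`. -/
def DiamLe {E : Type*} [MetricSpace E] (A : Set E) (r : ℝ) : Prop :=
  ∀ x ∈ A, ∀ y ∈ A, dist x y ≤ r

/-- All measurable sets of diameter at most `r` have mass at most `b`. -/
def Bd {E : Type*} [MetricSpace E] [MeasurableSpace E] (m : Measure E) (r b : ℝ) : Prop :=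
  ∀ A : Set E, MeasurableSet A → DiamLe A r → m.real A ≤ b

theorem iter_lemma {E : Type*} [MetricSpace E] [MeasurableSpace E] (m : Measure E)
    [IsProbabilityMeasure m] (δ θ σ C η0 : ℝ) (hδ : 0 < δ) (hδ1 : δ ≤ 1) (hθ0 : 0 ≤ θ) (hθ : θ < 1)
    (hσ : 0 < σ) (hσ1 : σ < 1) (hC : 0 ≤ C) (hη0 : 0 < η0)
    (h : ∀ r b, 0 < r → r ≤ δ → 0 ≤ b → Bd m (r / σ) b → Bd m r (θ * b + C * r ^ η0)) :
    ∃ lam eta : ℝ, 0 < lam ∧ 0 < eta ∧ ∀ r, 0 < r → Bd m r (lam * r ^ eta) := by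
  have hcont : Filter.Tendsto (fun η : ℝ => θ * (1 / σ) ^ η) (nhdsWithin 0 (Set.Ioi 0)) (nhds θ) := by
    have h1 : Continuous (fun η : ℝ => θ * (1 / σ) ^ η) :=
      continuous_const.mul (Real.continuous_const_rpow (by positivity))
    have h2 := (h1.tendsto 0).mono_left (nhdsWithin_le_nhds (s := Set.Ioi 0))
    simpa using h2
  have hev := (hcont.eventually (gt_mem_nhds hθ)).and
    (Ioc_mem_nhdsGT hη0 : ∀ᶠ x in nhdsWithin (0 : ℝ) (Set.Ioi 0), x ∈ Set.Ioc 0 η0)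
  obtain ⟨η, hη1, hη, hηη⟩ := hev.exists
  set κ := θ * (1 / σ) ^ η with hκ
  set lam := max (δ ^ (-η)) (C / (1 - κ)) with hlam
  have hl0 : 0 < lam := lt_of_lt_of_le (Real.rpow_pos_of_pos hδ _) (le_max_left _ _)
  have hl1 : C ≤ lam * (1 - κ) := by
    have : C / (1 - κ) ≤ lam := le_max_right _ _
    rwa [div_le_iff₀ (by linarith)] at this
  refine ⟨lam, η, hl0, hη, ?_⟩
  have key : ∀ k : ℕ, ∀ r, δ * σ ^ k ≤ r → Bd m r (lam * r ^ η) := by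
    have base : ∀ r, δ ≤ r → Bd m r (lam * r ^ η) := by
      intro r hr A hA hd
      refine measureReal_le_one.trans ?_
      have h1 : 1 = δ ^ (-η) * δ ^ η := by
        rw [← Real.rpow_add hδ]; simp
      rw [h1]
      have : δ ^ η ≤ r ^ η := Real.rpow_le_rpow hδ.le hr hη.le
      have h3 : δ ^ (-η) ≤ lam := le_max_left _ _
      gcongr
    intro k
    induction k with
    | zero => intro r hr; exact base r (by simpa using hr)
    | succ k ih =>
      intro r hr
      rcases le_total δ r with h1 | h1
      · exact base r h1
      have hr0 : 0 < r := lt_of_lt_of_le (by positivity) hr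
      have h2 : δ * σ ^ k ≤ r / σ := by
        rw [le_div_iff₀ hσ]; rw [pow_succ] at hr; linarith
      have h3 := h r _ hr0 h1 (by positivity) (ih _ h2)
      intro A hA hd
      refine (h3 A hA hd).trans ?_
      have h4 : (r / σ) ^ η = (1 / σ) ^ η * r ^ η := by
        rw [← Real.mul_rpow (by positivity) hr0.le]; congr 1; ring
      have h5 : r ^ η0 ≤ r ^ η := Real.rpow_le_rpow_of_exponent_ge hr0 (h1.trans hδ1) hηη
      have h6 : 0 ≤ r ^ η := by positivity
      calc θ * (lam * (r / σ) ^ η) + C * r ^ η0 ≤ θ * (lam * (r / σ) ^ η) + C * r ^ η := by gcongr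
        _ = (lam * κ + C) * r ^ η := by rw [h4, hκ]; ring
        _ ≤ lam * r ^ η := by
          apply mul_le_mul_of_nonneg_right _ h6
          linarith
  intro r hr
  obtain ⟨k, hk⟩ := exists_pow_lt_of_lt_one (div_pos hr hδ) hσ1
  refine key k r ?_
  rw [lt_div_iff₀ hδ] at hk
  linarith

theorem surj_of_dil {q : ℕ} (g : EuclideanSpace ℝ (Fin q) → EuclideanSpace ℝ (Fin q)) (c : ℝ)
    (hc : 0 < c) (hg : ∀ x y, dist (g x) (g y) = c * dist x y) : Function.Surjective g := by
  let g' : EuclideanSpace ℝ (Fin q) → EuclideanSpace ℝ (Fin q) := fun x => c⁻¹ • g x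
  have hi : Isometry g' := by
    refine Isometry.of_dist_eq fun x y => ?_
    simp only [g', dist_smul₀, hg]
    rw [Real.norm_of_nonneg (by positivity)]
    field_simp
  let a := hi.affineIsometryOfStrictConvexSpace
  have hs : Function.Surjective a := by
    have h1 : Function.Surjective a.linearIsometry :=
      (a.linearIsometry.toLinearIsometryEquiv rfl).surjective
    have h2 : Function.Surjective a.toAffineMap.linear := h1
    have := (AffineMap.linear_surjective_iff a.toAffineMap).1 h2
    exact this
  intro y
  obtain ⟨x, hx⟩ := hs (c⁻¹ • y)
  refine ⟨x, ?_⟩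
  have : c⁻¹ • g x = c⁻¹ • y := hx
  exact smul_right_injective _ (inv_ne_zero hc.ne') this

theorem iter_dist {E : Type*} [MetricSpace E] (g : E → E) (c : ℝ)
    (hg : ∀ x y, dist (g x) (g y) = c * dist x y) (n : ℕ) (x y : E) :
    dist (g^[n] x) (g^[n] y) = c ^ n * dist x y := by
  induction n with
  | zero => simp
  | succ n ih => rw [Function.iterate_succ_apply', Function.iterate_succ_apply', hg, ih]; ring

theorem no_common_fix {q : ℕ} (f g : EuclideanSpace ℝ (Fin q) → EuclideanSpace ℝ (Fin q)) (c d : ℝ)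
    (hc : 0 < c) (hd : 0 < d) (hf : ∀ x y, dist (f x) (f y) = c * dist x y)
    (hg : ∀ x y, dist (g x) (g y) = d * dist x y)
    (U : Set (EuclideanSpace ℝ (Fin q))) (hU : U.Nonempty) (hUo : IsOpen U)
    (hdis : Disjoint (f '' U) (g '' U)) (hfU : f '' U ⊆ U) (hgU : g '' U ⊆ U)
    (a : EuclideanSpace ℝ (Fin q)) (hfa : f a = a) (hga : g a = a) : False := by
  obtain ⟨u, hu⟩ := hU
  obtain ⟨r, hr, hrU⟩ := Metric.isOpen_iff.1 hUo u hu
  have hfm : Set.MapsTo f U U := fun x hx => hfU ⟨x, hx, rfl⟩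
  have hgm : Set.MapsTo g U U := fun x hx => hgU ⟨x, hx, rfl⟩
  have hfn : ∀ n, Set.MapsTo (f^[n]) U U := fun n => hfm.iterate n
  have hfinj : Function.Injective f := by
    intro x y h
    have := hf x y
    rw [h, dist_self] at this
    have h2 := mul_eq_zero.1 this.symm
    exact dist_eq_zero.1 (h2.resolve_left hc.ne')
  have hfan : ∀ n, f^[n] a = a := fun n => Function.iterate_fixed hfa n
  obtain ⟨S, hSf, hScov⟩ := Metric.totallyBounded_iff.1
    (isCompact_closedBall a (dist u a)).totallyBounded (r / 2) (by positivity)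
  obtain ⟨n, hn⟩ : ∃ n, n = hSf.toFinset.card := ⟨_, rfl⟩
  let W : ℕ → EuclideanSpace ℝ (Fin q) → EuclideanSpace ℝ (Fin q) :=
    fun k x => f^[k] (g (f^[n - k] x))
  have hW : ∀ k ≤ n, ∀ x y, dist (W k x) (W k y) = (c ^ n * d) * dist x y := by
    intro k hk x y
    simp only [W]
    rw [iter_dist f c hf, hg, iter_dist f c hf, ← Nat.add_sub_cancel' hk, pow_add]
    simp; ring
  have hcd : 0 < c ^ n * d := by positivity
  have hWa : ∀ k, W k a = a := by intro k; simp only [W, hfan, hga]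
  have hlt : ∀ k j, k < j → j ≤ n → ∀ x ∈ U, ∀ y ∈ U, W k x ≠ W j y := by
    intro k j hkj hj x hx y hy h
    obtain ⟨m, rfl⟩ := Nat.exists_eq_add_of_lt hkj
    simp only [W] at h
    rw [show k + m + 1 = k + (m + 1) by ring, Function.iterate_add_apply] at h
    have h2 := hfinj.iterate k h
    rw [Function.iterate_succ_apply'] at h2
    have h3 : g (f^[n - k] x) ∈ f '' U := by
      rw [h2]
      exact ⟨_, hfn _ (hgm (hfn _ hy)), rfl⟩
    exact Set.disjoint_left.1 hdis h3 ⟨_, hfn _ hx, rfl⟩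
  have hne : ∀ k j, k ≠ j → k ≤ n → j ≤ n → ∀ x ∈ U, ∀ y ∈ U, W k x ≠ W j y := by
    intro k j hkj hk hj x hx y hy
    rcases lt_or_gt_of_ne hkj with h | h
    · exact hlt k j h hj x hx y hy
    · exact (hlt j k h hk y hy x hx).symm
  let z : ℕ → EuclideanSpace ℝ (Fin q) := fun k => a + (c ^ n * d)⁻¹ • (W k u - a)
  have hzz : ∀ k j, dist (z k) (z j) = (c ^ n * d)⁻¹ * dist (W k u) (W j u) := by
    intro k j
    simp only [z, dist_add_left, dist_smul₀, dist_sub_right]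
    rw [Real.norm_of_nonneg (by positivity)]
  have hza : ∀ k ≤ n, z k ∈ closedBall a (dist u a) := by
    intro k hk
    have : ‖z k - a‖ = dist u a := by
      simp only [z, add_sub_cancel_left, norm_smul]
      rw [Real.norm_of_nonneg (by positivity), ← dist_eq_norm]
      conv_lhs => rw [← hWa k]
      rw [hW k hk]
      field_simp
    rw [mem_closedBall, dist_eq_norm, this]
  have hsel : ∀ k : ℕ, ∃ y, k ≤ n → y ∈ S ∧ dist (z k) y < r / 2 := by
    intro k
    by_cases hk : k ≤ n
    · have := hScov (hza k hk)
      simp only [Set.mem_iUnion, mem_ball] at this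
      obtain ⟨y, hy, h⟩ := this
      exact ⟨y, fun _ => ⟨hy, h⟩⟩
    · exact ⟨a, fun h => absurd h hk⟩
  choose φ hφ using hsel
  obtain ⟨k, hk, j, hj, hkj, he⟩ := Finset.exists_ne_map_eq_of_card_lt_of_maps_to
    (s := Finset.range (n + 1)) (t := hSf.toFinset) (f := φ) (by simp [← hn])
    (by
      intro k hk
      simp only [Finset.coe_range, Set.mem_Iio] at hk
      simpa using (hφ k (by omega)).1)
  simp only [Finset.mem_range] at hk hj
  have hk' : k ≤ n := by omega
  have hj' : j ≤ n := by omega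
  have hdz : dist (z k) (z j) < r := by
    have h1 := (hφ k hk').2
    have h2 := (hφ j hj').2
    rw [← he, dist_comm] at h2
    linarith [dist_triangle (z k) (φ k) (z j)]
  rw [hzz] at hdz
  obtain ⟨x, hx⟩ := surj_of_dil (W k) _ hcd (hW k hk') (W j u)
  refine hne k j hkj hk' hj' x (hrU ?_) u hu hx
  rw [← hx, hW k hk'] at hdz
  rw [mem_ball, dist_comm]
  rwa [inv_mul_cancel_left₀ hcd.ne'] at hdz

theorem diamLe_preimage {E : Type*} [MetricSpace E] (g : E → E) (c σ r : ℝ) (hσ : 0 < σ)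
    (hc : σ ≤ c) (hg : ∀ x y, dist (g x) (g y) = c * dist x y) (A : Set E) (hA : DiamLe A r) :
    DiamLe (g ⁻¹' A) (r / σ) := by
  intro x hx y hy
  have := hA _ hx _ hy
  rw [hg] at this
  rw [le_div_iff₀ hσ]
  nlinarith [dist_nonneg (x := x) (y := y)]

theorem meas_of_dil {E : Type*} [MetricSpace E] [MeasurableSpace E] [BorelSpace E] (g : E → E) (c : ℝ)
    (hc : 0 < c) (hg : ∀ x y, dist (g x) (g y) = c * dist x y) : Continuous g := by
  have : LipschitzWith ⟨c, hc.le⟩ g := LipschitzWith.of_dist_le_mul fun x y => (hg x y).le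
  exact this.continuous

theorem real_expand {E : Type*} [MeasurableSpace E] {N : ℕ} (ν : Measure E) [IsFiniteMeasure ν]
    (f : Fin N → E → E) (hf : ∀ i, Measurable (f i)) (t : Fin N → ℝ) (ht : ∀ i, 0 < t i)
    (A : Set E) (hA : MeasurableSet A) :
    (∑ i, ENNReal.ofReal (t i) • ν.map (f i)).real A = ∑ i, t i * ν.real (f i ⁻¹' A) := by
  simp only [Measure.real, Measure.coe_finset_sum, Finset.sum_apply, Measure.smul_apply, smul_eq_mul]
  rw [ENNReal.toReal_sum]
  · refine Finset.sum_congr rfl fun i _ => ?_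
    rw [Measure.map_apply (hf i) hA, ENNReal.toReal_mul, ENNReal.toReal_ofReal (ht i).le]
  · intro i _
    rw [Measure.map_apply (hf i) hA]
    exact ENNReal.mul_ne_top ENNReal.ofReal_ne_top (measure_ne_top _ _)

theorem bounded_supp {E : Type*} [NormedAddCommGroup E] [MeasurableSpace E] [BorelSpace E] {N : ℕ}
    (hN : 0 < N)
    (f : Fin N → E → E) (s : Fin N → ℝ) (hs : ∀ i, s i ∈ Set.Ioo (0 : ℝ) 1)
    (hf : ∀ i x y, dist (f i x) (f i y) = s i * dist x y)
    (t : Fin N → ℝ) (ht : ∀ i, 0 < t i) (htsum : ∑ i, t i = 1)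
    (ν : Measure E) [IsProbabilityMeasure ν]
    (hν : ∀ A, MeasurableSet A → ν.real A = ∑ i, t i * ν.real (f i ⁻¹' A)) :
    ∃ R : ℝ, 0 < R ∧ ν.real {x | R < ‖x‖} = 0 := by
  haveI : Nonempty (Fin N) := ⟨⟨0, hN⟩⟩
  obtain ⟨i1, hi1⟩ := Finite.exists_max s
  obtain ⟨i2, hi2⟩ := Finite.exists_max (fun i => ‖f i 0‖)
  set σ := s i1
  set c := ‖f i2 0‖
  have hσ0 : 0 < σ := (hs i1).1
  have hσ1 : σ < 1 := (hs i1).2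
  have hc : 0 ≤ c := norm_nonneg _
  set R0 := c / (1 - σ)
  have hR0 : c = R0 * (1 - σ) := by
    have : 1 - σ ≠ 0 := by linarith
    simp only [R0]; field_simp
  have hR00 : 0 ≤ R0 := div_nonneg hc (by linarith)
  have hmeas : ∀ R : ℝ, MeasurableSet {x : E | R < ‖x‖} := fun R =>
    (isOpen_lt continuous_const continuous_norm).measurableSet
  have step : ∀ ρ, 0 < ρ → ν.real {x | R0 + ρ < ‖x‖} ≤ ν.real {x | R0 + ρ / σ < ‖x‖} := by
    intro ρ hρ
    rw [hν _ (hmeas _)]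
    calc ∑ i, t i * ν.real (f i ⁻¹' {x | R0 + ρ < ‖x‖})
        ≤ ∑ i, t i * ν.real {x | R0 + ρ / σ < ‖x‖} := by
          refine Finset.sum_le_sum fun i _ => mul_le_mul_of_nonneg_left ?_ (ht i).le
          refine measureReal_mono ?_
          intro x hx
          simp only [Set.mem_preimage, Set.mem_setOf_eq] at hx ⊢
          have h1 : ‖f i x‖ ≤ ‖f i 0‖ + s i * ‖x‖ := by
            have := hf i x 0
            rw [dist_zero_right, dist_eq_norm] at this
            rw [← this]
            have := norm_add_le (f i 0) (f i x - f i 0)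
            simpa using this
          have h2 : s i * ‖x‖ ≤ σ * ‖x‖ := mul_le_mul_of_nonneg_right (hi1 i) (norm_nonneg _)
          have h3 := hi2 i
          have h4 : R0 + ρ < R0 * (1 - σ) + σ * ‖x‖ := by
            rw [← hR0]; linarith
          have h5 : ρ / σ < ‖x‖ - R0 := by
            rw [div_lt_iff₀ hσ0]; nlinarith
          linarith
      _ = _ := by rw [← Finset.sum_mul, htsum, one_mul]
  have hn : ∀ n : ℕ, ν.real {x | R0 + 1 < ‖x‖} ≤ ν.real {x | R0 + (1 / σ) ^ n < ‖x‖} := by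
    intro n
    induction n with
    | zero => simp
    | succ n ih =>
      refine ih.trans ((step _ (by positivity)).trans_eq ?_)
      congr 3
      rw [pow_succ]; ring_nf
  have h1σ : 1 < 1 / σ := by rw [lt_div_iff₀ hσ0]; linarith
  have hlim : Filter.Tendsto (fun n : ℕ => ν {x | R0 + (1 / σ) ^ n < ‖x‖}) Filter.atTop
      (nhds (ν (⋂ n : ℕ, {x | R0 + (1 / σ) ^ n < ‖x‖}))) := by
    refine tendsto_measure_iInter_atTop (fun n => (hmeas _).nullMeasurableSet) ?_
      ⟨0, measure_ne_top _ _⟩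
    intro m n hmn x hx
    simp only [Set.mem_setOf_eq, Set.le_eq_subset] at hx ⊢
    have := pow_le_pow_right₀ h1σ.le hmn
    linarith
  have hemp : (⋂ n : ℕ, {x : E | R0 + (1 / σ) ^ n < ‖x‖}) = ∅ := by
    ext x
    simp only [Set.mem_iInter, Set.mem_setOf_eq, Set.mem_empty_iff_false, iff_false, not_forall,
      not_lt]
    obtain ⟨n, hn⟩ := pow_unbounded_of_one_lt ‖x‖ h1σ
    exact ⟨n, by linarith⟩
  rw [hemp, measure_empty] at hlim
  have hlim2 : Filter.Tendsto (fun n : ℕ => ν.real {x | R0 + (1 / σ) ^ n < ‖x‖}) Filter.atTop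
      (nhds 0) := by
    have := (ENNReal.tendsto_toReal ENNReal.zero_ne_top).comp hlim
    simpa [Measure.real, Function.comp_def] using this
  exact ⟨R0 + 1, by linarith, le_antisymm (ge_of_tendsto' hlim2 hn) measureReal_nonneg⟩

theorem miss_lemma {E : Type*} [MetricSpace E] [MeasurableSpace E] [BorelSpace E] {N : ℕ}
    (f : Fin N → E → E) (s : Fin N → ℝ) (σ : ℝ) (hσ : 0 < σ) (hσ1 : σ < 1) (hσs : ∀ i, σ ≤ s i)
    (hf : ∀ i x y, dist (f i x) (f i y) = s i * dist x y)
    (t : Fin N → ℝ) (ht : ∀ i, 0 < t i) (htsum : ∑ i, t i = 1)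
    (ν : Measure E) [IsProbabilityMeasure ν]
    (hν : ∀ A, MeasurableSet A → ν.real A = ∑ i, t i * ν.real (f i ⁻¹' A))
    (K : Set E) (hK : ν.real Kᶜ = 0) (i0 : Fin N) (b : ℝ) (hb : 0 ≤ b) (n : ℕ) :
    ∀ (r : ℝ) (A : Set E), 0 ≤ r → MeasurableSet A → DiamLe A r → Bd ν (r / σ ^ n) b →
      ((f i0)^[n] ⁻¹' A) ⊆ Kᶜ → ν.real A ≤ (1 - t i0 ^ n) * b := by
  induction n with
  | zero =>
    intro r A _ hA hd hbd hsub
    simp only [Function.iterate_zero, Set.preimage_id] at hsub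
    have := measureReal_mono (μ := ν) hsub
    simpa using this.trans hK.le
  | succ n ih =>
    intro r A hr hA hd hbd hsub
    have hfm : ∀ i, Measurable (f i) := fun i =>
      (meas_of_dil (f i) (s i) (hσ.trans_le (hσs i)) (hf i)).measurable
    have hp : ∀ i, DiamLe (f i ⁻¹' A) (r / σ) := fun i =>
      diamLe_preimage (f i) (s i) σ r hσ (hσs i) (hf i) A hd
    have hmono : r / σ ≤ r / σ ^ (n + 1) := by
      apply div_le_div_of_nonneg_left hr (by positivity)
      rw [pow_succ]
      have := pow_le_one₀ (n := n) hσ.le hσ1.le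
      nlinarith
    have h1 : ν.real (f i0 ⁻¹' A) ≤ (1 - t i0 ^ n) * b := by
      refine ih (r / σ) _ (by positivity) (hfm i0 hA) (hp i0) ?_ ?_
      · rwa [div_div, ← pow_succ']
      · rw [← Set.preimage_comp, ← Function.iterate_succ']
        exact hsub
    have h2 : ∀ i, ν.real (f i ⁻¹' A) ≤ b := fun i =>
      hbd _ (hfm i hA) fun x hx y hy => (hp i x hx y hy).trans hmono
    rw [hν A hA]
    rw [← Finset.add_sum_erase _ _ (Finset.mem_univ i0)]
    have h3 : ∑ i ∈ Finset.univ.erase i0, t i * ν.real (f i ⁻¹' A)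
        ≤ ∑ i ∈ Finset.univ.erase i0, t i * b :=
      Finset.sum_le_sum fun i _ => mul_le_mul_of_nonneg_left (h2 i) (ht i).le
    rw [← Finset.sum_mul] at h3
    have h4 : ∑ i ∈ Finset.univ.erase i0, t i = 1 - t i0 := by
      rw [← htsum, ← Finset.add_sum_erase _ _ (Finset.mem_univ i0)]; ring
    rw [h4] at h3
    have h5 := mul_le_mul_of_nonneg_left h1 (ht i0).le
    calc _ ≤ t i0 * ((1 - t i0 ^ n) * b) + (1 - t i0) * b := add_le_add h5 h3
      _ = _ := by rw [pow_succ]; ring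

theorem exists_fix {E : Type*} [MetricSpace E] [CompleteSpace E] [Nonempty E] (g : E → E) (c : ℝ)
    (hc : c ∈ Set.Ioo (0 : ℝ) 1) (hg : ∀ x y, dist (g x) (g y) = c * dist x y) : ∃ a, g a = a := by
  have h : ContractingWith ⟨c, hc.1.le⟩ g :=
    ⟨NNReal.coe_lt_coe.1 hc.2, LipschitzWith.of_dist_le_mul fun x y => (hg x y).le⟩
  exact ⟨_, h.fixedPoint_isFixedPt⟩

theorem stmt2 (q N : ℕ) (hq : 1 ≤ q) (hN : 2 ≤ N)
    (f : Fin N → EuclideanSpace ℝ (Fin q) → EuclideanSpace ℝ (Fin q))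
    (s : Fin N → ℝ) (hs : ∀ i, s i ∈ Set.Ioo (0 : ℝ) 1)
    (hf : ∀ i x y, dist (f i x) (f i y) = s i * dist x y)
    (hOSC : ∃ U : Set (EuclideanSpace ℝ (Fin q)), U.Nonempty ∧ IsOpen U ∧
      Bornology.IsBounded U ∧
      (∀ i j, i ≠ j → Disjoint (f i '' U) (f j '' U)) ∧
      (⋃ i, f i '' U) ⊆ U)
    (t : Fin N → ℝ) (ht : ∀ i, 0 < t i) (htsum : ∑ i, t i = 1)
    (ν : Measure (EuclideanSpace ℝ (Fin q))) (hνp : IsProbabilityMeasure ν)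
    (hν : ν = ∑ i, ENNReal.ofReal (t i) • ν.map (f i))
    (p : Fin (N + 1) → ℝ) (hp : ∀ i, 0 < p i) (hpsum : ∑ i, p i = 1)
    (μ : Measure (EuclideanSpace ℝ (Fin q))) (hμp : IsProbabilityMeasure μ)
    (hμ : μ = ENNReal.ofReal (p 0) • ν + ∑ i : Fin N, ENNReal.ofReal (p i.succ) • μ.map (f i)) :
    ∃ lam : ℝ, 0 < lam ∧ ∃ eta : ℝ, 0 < eta ∧
      ∀ (x : EuclideanSpace ℝ (Fin q)) (ε : ℝ), 0 < ε →
        μ (closedBall x ε) ≤ ENNReal.ofReal (lam * ε ^ eta) := by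
  have hfm : ∀ i, Measurable (f i) := fun i =>
    (meas_of_dil (f i) (s i) (hs i).1 (hf i)).measurable
  have hνe : ∀ A, MeasurableSet A → ν.real A = ∑ i, t i * ν.real (f i ⁻¹' A) := by
    intro A hA
    conv_lhs => rw [hν]
    exact real_expand ν f hfm t ht A hA
  have hμe : ∀ A, MeasurableSet A →
      μ.real A = p 0 * ν.real A + ∑ i : Fin N, p i.succ * μ.real (f i ⁻¹' A) := by
    intro A hA
    rw [← real_expand μ f hfm (fun i => p i.succ) (fun i => hp _) A hA]
    have hfin : (∑ i : Fin N, ENNReal.ofReal (p i.succ) • μ.map (f i)) A ≠ ⊤ := by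
      refine ne_top_of_le_ne_top (measure_ne_top μ A) ?_
      conv_rhs => rw [hμ]
      rw [Measure.add_apply]
      exact le_add_self
    conv_lhs => rw [hμ]
    rw [Measure.real, Measure.add_apply, ENNReal.toReal_add _ hfin, Measure.smul_apply, smul_eq_mul,
      ENNReal.toReal_mul, ENNReal.toReal_ofReal (hp 0).le]
    · rfl
    · rw [Measure.smul_apply, smul_eq_mul]
      exact ENNReal.mul_ne_top ENNReal.ofReal_ne_top (measure_ne_top _ _)
  haveI : Nonempty (Fin N) := ⟨⟨0, by omega⟩⟩
  obtain ⟨im, him⟩ := Finite.exists_min s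
  set σ := s im
  have hσ0 : 0 < σ := (hs im).1
  have hσ1 : σ < 1 := (hs im).2
  let i0 : Fin N := ⟨0, by omega⟩
  let i1 : Fin N := ⟨1, by omega⟩
  have hi01 : i0 ≠ i1 := by simp [i0, i1]
  obtain ⟨a, ha⟩ := exists_fix (f i0) (s i0) (hs i0) (hf i0)
  obtain ⟨b, hb⟩ := exists_fix (f i1) (s i1) (hs i1) (hf i1)
  have hab : a ≠ b := by
    rintro rfl
    obtain ⟨U, hU, hUo, -, hdis, hsub⟩ := hOSC
    exact no_common_fix (f i0) (f i1) (s i0) (s i1) (hs i0).1 (hs i1).1 (hf i0) (hf i1) U hU hUo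
      (hdis _ _ hi01) ((Set.subset_iUnion (fun i => f i '' U) i0).trans hsub)
      ((Set.subset_iUnion (fun i => f i '' U) i1).trans hsub) a ha hb
  have hD : 0 < dist a b := dist_pos.2 hab
  obtain ⟨R, hR, hRν⟩ := bounded_supp (by omega) f s hs hf t ht htsum ν hνe
  set M := R + ‖a‖ + ‖b‖ with hM
  have hM0 : 0 < M := by positivity
  have hsm : ∃ n : ℕ, s i0 ^ n * M < dist a b / 4 ∧ s i1 ^ n * M < dist a b / 4 := by
    have h0 := ((tendsto_pow_atTop_nhds_zero_of_lt_one (hs i0).1.le (hs i0).2).mul_const M)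
    have h1 := ((tendsto_pow_atTop_nhds_zero_of_lt_one (hs i1).1.le (hs i1).2).mul_const M)
    rw [zero_mul] at h0 h1
    have h4 : 0 < dist a b / 4 := by positivity
    exact ((h0.eventually (gt_mem_nhds h4)).and (h1.eventually (gt_mem_nhds h4))).exists
  obtain ⟨n, hn0, hn1⟩ := hsm
  have htle : ∀ i, t i ≤ 1 := fun i => by
    rw [← htsum]; exact Finset.single_le_sum (fun j _ => (ht j).le) (Finset.mem_univ i)
  set τ := min (t i0 ^ n) (t i1 ^ n) with hτ
  have hτ0 : 0 < τ := lt_min (pow_pos (ht _) _) (pow_pos (ht _) _)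
  have hτ1 : τ ≤ 1 := (min_le_left _ _).trans (pow_le_one₀ (ht _).le (htle _))
  let K : Set (EuclideanSpace ℝ (Fin q)) := {x | R < ‖x‖}ᶜ
  have hK : ν.real Kᶜ = 0 := by simpa [K] using hRν
  have hKd : ∀ x ∈ K, dist x a ≤ M ∧ dist x b ≤ M := by
    intro x hx
    simp only [K, Set.mem_compl_iff, Set.mem_setOf_eq, not_lt] at hx
    constructor
    · have := dist_le_norm_add_norm x a; have := norm_nonneg b; linarith
    · have := dist_le_norm_add_norm x b; have := norm_nonneg a; linarith
  -- bound for ν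
  have hνb : ∃ lam eta : ℝ, 0 < lam ∧ 0 < eta ∧ ∀ r, 0 < r → Bd ν r (lam * r ^ eta) := by
    have hpow : 0 < σ ^ (n + 1) ∧ σ ^ (n + 1) < 1 :=
      ⟨by positivity, pow_lt_one₀ hσ0.le hσ1 (by omega)⟩
    refine iter_lemma ν (min 1 (dist a b / 4)) (1 - τ) (σ ^ (n + 1)) 0 1 (by positivity)
      (min_le_left _ _) (by linarith) (by linarith) hpow.1 hpow.2 le_rfl one_pos ?_
    intro r β hr hrδ hβ hbd A hA hdA
    rw [zero_mul, add_zero]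
    have hbd' : Bd ν (r / σ ^ n) β := by
      intro A hA hd
      refine hbd A hA fun x hx y hy => (hd x hx y hy).trans ?_
      apply div_le_div_of_nonneg_left hr.le (by positivity)
      rw [pow_succ]
      have : 0 < σ ^ n := by positivity
      nlinarith
    have hr4 : r ≤ dist a b / 4 := hrδ.trans (min_le_right _ _)
    have hdich : ((f i0)^[n] ⁻¹' A) ⊆ Kᶜ ∨ ((f i1)^[n] ⁻¹' A) ⊆ Kᶜ := by
      by_contra hcon
      rw [not_or, Set.not_subset, Set.not_subset] at hcon
      obtain ⟨⟨x, hxA, hxK⟩, ⟨y, hyA, hyK⟩⟩ := hcon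
      rw [Set.notMem_compl_iff] at hxK hyK
      have h1 := hdA _ hxA _ hyA
      have h2 := iter_dist (f i0) (s i0) (hf i0) n x a
      have h3 := iter_dist (f i1) (s i1) (hf i1) n y b
      rw [Function.iterate_fixed ha] at h2
      rw [Function.iterate_fixed hb] at h3
      have h4 := mul_le_mul_of_nonneg_left (hKd x hxK).1 (pow_pos (hs i0).1 n).le
      have h5 := mul_le_mul_of_nonneg_left (hKd y hyK).2 (pow_pos (hs i1).1 n).le
      have h6 := dist_triangle4 a ((f i0)^[n] x) ((f i1)^[n] y) b
      rw [dist_comm a ((f i0)^[n] x)] at h6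
      linarith
    rcases hdich with h | h
    · refine (miss_lemma f s σ hσ0 hσ1 him hf t ht htsum ν hνe K hK i0 β hβ n r A hr.le hA hdA
        hbd' h).trans ?_
      have := min_le_left (t i0 ^ n) (t i1 ^ n)
      gcongr
    · refine (miss_lemma f s σ hσ0 hσ1 him hf t ht htsum ν hνe K hK i1 β hβ n r A hr.le hA hdA
        hbd' h).trans ?_
      have := min_le_right (t i0 ^ n) (t i1 ^ n)
      gcongr
  obtain ⟨C, η, hC, hη, hνC⟩ := hνb
  have hps : ∑ i : Fin N, p i.succ = 1 - p 0 := by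
    rw [Fin.sum_univ_succ] at hpsum; linarith
  have hp1 : 0 ≤ 1 - p 0 := by
    rw [← hps]; exact Finset.sum_nonneg fun i _ => (hp _).le
  have hμb : ∃ lam eta : ℝ, 0 < lam ∧ 0 < eta ∧ ∀ r, 0 < r → Bd μ r (lam * r ^ eta) := by
    refine iter_lemma μ 1 (1 - p 0) σ (p 0 * C) η one_pos le_rfl hp1 (by linarith [hp 0]) hσ0 hσ1
      (mul_nonneg (hp 0).le hC.le) hη ?_
    intro r β hr _ hβ hbd A hA hdA
    rw [hμe A hA]
    have h1 := mul_le_mul_of_nonneg_left (hνC r hr A hA hdA) (hp 0).le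
    have h2 : ∑ i : Fin N, p i.succ * μ.real (f i ⁻¹' A) ≤ ∑ i : Fin N, p i.succ * β :=
      Finset.sum_le_sum fun i _ => mul_le_mul_of_nonneg_left
        (hbd _ (hfm i hA) (diamLe_preimage (f i) (s i) σ r hσ0 (him i) (hf i) A hdA)) (hp _).le
    rw [← Finset.sum_mul, hps] at h2
    linarith
  obtain ⟨L, e, hL, he, hLe⟩ := hμb
  refine ⟨L * 2 ^ e, by positivity, e, he, fun x ε hε => ?_⟩
  have h := hLe (2 * ε) (by positivity) (closedBall x ε) isClosed_closedBall.measurableSet ?_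
  · rw [Real.mul_rpow (by norm_num) hε.le, ← mul_assoc] at h
    exact (ENNReal.le_ofReal_iff_toReal_le (measure_ne_top _ _) (by positivity)).2 h
  · intro y hy z hz
    rw [mem_closedBall] at hy hz
    have := dist_triangle_right y z x
    linarith
end

section
/- There exist constants λ₁ > 0 and η₁ > 0 such that μ(B(x,ε)) ≤ λ₁ ε^{η₁} for every x ∈ ℝ^q and every ε > 0, where B(x,ε) denotes the closed ball of radius ε centered at x. -/
open MeasureTheory Metric

/-- The topological support of a measure: points all of whose open neighbourhoods
have positive measure. -/
def msupport {q : ℕ} (ν : Measure (EuclideanSpace ℝ (Fin q))) : Set (EuclideanSpace ℝ (Fin q)) :=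
  {x | ∀ U : Set (EuclideanSpace ℝ (Fin q)), IsOpen U → x ∈ U → ν U ≠ 0}


/-- all distances inside `B` are at most `d` -/
def DB {F : Type*} [MetricSpace F] (B : Set F) (d : ℝ) : Prop := ∀ x ∈ B, ∀ y ∈ B, dist x y ≤ d

theorem DB_pre {F : Type*} [MetricSpace F] (g : F → F) (c ρ d : ℝ) (hρ : 0 < ρ) (hc : ρ ≤ c)
    (hg : ∀ x y, dist (g x) (g y) = c * dist x y) (B : Set F) (hB : DB B d) :
    DB (g ⁻¹' B) (d / ρ) := by
  intro x hx y hy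
  have h := hB _ hx _ hy
  rw [hg] at h
  rw [le_div_iff₀ hρ]
  nlinarith [@dist_nonneg _ _ x y]

theorem sim_cont {F : Type*} [MetricSpace F] (g : F → F) (c : ℝ) (hc : 0 < c)
    (hg : ∀ x y, dist (g x) (g y) = c * dist x y) : Continuous g := by
  have : LipschitzWith (⟨c, hc.le⟩ : NNReal) g := LipschitzWith.of_dist_le_mul fun x y => (hg x y).le
  exact this.continuous

theorem exists_eta (θ ρ a : ℝ) (hθ : 0 ≤ θ) (hθ1 : θ < 1) (hρ : 0 < ρ) (ha : 0 < a) :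
    ∃ η, 0 < η ∧ η ≤ a ∧ θ * (1 / ρ) ^ η ≤ (1 + θ) / 2 := by
  have hcont : Continuous fun η : ℝ => θ * (1 / ρ) ^ η := by
    have : (1 / ρ) ≠ 0 := by positivity
    exact continuous_const.mul (Real.continuous_const_rpow this)
  have h0 := (hcont.tendsto 0).eventually (gt_mem_nhds (show θ * (1 / ρ) ^ (0:ℝ) < (1 + θ) / 2 by rw [Real.rpow_zero]; linarith))
  obtain ⟨δ, hδ, h⟩ := Metric.eventually_nhds_iff.1 h0
  refine ⟨min (δ / 2) a, by positivity, min_le_right _ _, (h ?_).le⟩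
  have h1 : 0 < min (δ / 2) a := by positivity
  rw [Real.dist_eq, sub_zero, abs_of_pos h1]
  have := min_le_left (δ / 2) a
  linarith

theorem final_lemma {F : Type*} [MetricSpace F] [MeasurableSpace F] (m : Measure F)
    (hm : IsProbabilityMeasure m) (K a θ ρ d₀ : ℝ) (hK : 0 ≤ K) (ha : 0 < a) (hθ : 0 ≤ θ)
    (hθ1 : θ < 1) (hρ : 0 < ρ) (hρ1 : ρ < 1) (hd₀ : 0 < d₀)
    (H : ∀ d, 0 < d → d < d₀ → ∀ S : ℝ, 0 ≤ S →
      (∀ B, MeasurableSet B → DB B (d / ρ) → m.real B ≤ S) →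
      ∀ B, MeasurableSet B → DB B d → m.real B ≤ K * d ^ a + θ * S) :
    ∃ lam η : ℝ, 0 < lam ∧ 0 < η ∧
      ∀ d, 0 < d → ∀ B, MeasurableSet B → DB B d → m.real B ≤ lam * d ^ η := by
  obtain ⟨η, hη, hηa, hη2⟩ := exists_eta θ ρ a hθ hθ1 hρ ha
  set e := min d₀ 1 with he
  have he0 : 0 < e := by positivity
  have heη : 0 < e ^ η := by positivity
  set lam := max (1 / e ^ η) (2 * K / (1 - θ)) with hlam
  have hlam0 : 0 < lam := lt_of_lt_of_le (by positivity) (le_max_left _ _)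
  have hl1 : 1 ≤ lam * e ^ η := by
    have := le_max_left (1 / e ^ η) (2 * K / (1 - θ))
    rw [div_le_iff₀ heη] at this
    exact this
  have hl2 : 2 * K ≤ lam * (1 - θ) := by
    have := le_max_right (1 / e ^ η) (2 * K / (1 - θ))
    rw [div_le_iff₀ (by linarith)] at this
    exact this
  refine ⟨lam, η, hlam0, hη, ?_⟩
  have key : ∀ n : ℕ, ∀ d, 0 < d → e * ρ ^ n ≤ d → ∀ B, MeasurableSet B → DB B d →
      m.real B ≤ lam * d ^ η := by
    intro n
    induction n with
    | zero =>
      intro d hd hed B _ _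
      have h1 : e ^ η ≤ d ^ η := Real.rpow_le_rpow he0.le (by simpa using hed) hη.le
      have h2 : m.real B ≤ 1 := measureReal_le_one
      nlinarith
    | succ n ih =>
      intro d hd hed B hBm hB
      by_cases hde : e ≤ d
      · have h1 : e ^ η ≤ d ^ η := Real.rpow_le_rpow he0.le hde hη.le
        have h2 : m.real B ≤ 1 := measureReal_le_one
        nlinarith
      · push Not at hde
        have hd1 : d ≤ 1 := hde.le.trans (min_le_right _ _)
        have h1 := H d hd (hde.trans_le (min_le_left _ _)) (lam * (d / ρ) ^ η) (by positivity)
          (ih (d / ρ) (by positivity) (by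
            rw [le_div_iff₀ hρ, mul_assoc, ← pow_succ]; exact hed)) B hBm hB
        have h2 : d ^ a ≤ d ^ η := Real.rpow_le_rpow_of_exponent_ge hd hd1 hηa
        have h3 : (d / ρ) ^ η = (1 / ρ) ^ η * d ^ η := by
          rw [← Real.mul_rpow (by positivity) hd.le]; congr 1; ring
        have h4 : 0 < d ^ η := by positivity
        rw [h3] at h1
        have h5 : θ * (lam * ((1 / ρ) ^ η * d ^ η)) ≤ (1 + θ) / 2 * (lam * d ^ η) := by
          have := mul_le_mul_of_nonneg_right hη2 (show 0 ≤ lam * d ^ η by positivity)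
          linarith
        have h6 : K * d ^ a ≤ K * d ^ η := mul_le_mul_of_nonneg_left h2 hK
        nlinarith [mul_le_mul_of_nonneg_right hl2 h4.le]
  intro d hd
  obtain ⟨n, hn⟩ := exists_pow_lt_of_lt_one (div_pos hd he0) hρ1
  rw [lt_div_iff₀ he0] at hn
  exact key n d hd (by linarith)

theorem sim_linear {F : Type*} [NormedAddCommGroup F] [InnerProductSpace ℝ F]
    [FiniteDimensional ℝ F] (g : F → F) (c : ℝ) (hc : 0 < c)
    (hg : ∀ x y, dist (g x) (g y) = c * dist x y) (x₀ : F) (hx : g x₀ = x₀) :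
    ∃ A : F →ₗᵢ[ℝ] F, Function.Surjective A ∧ ∀ v, g (x₀ + v) = x₀ + c • A v := by
  let h : F → F := fun v => c⁻¹ • (g (x₀ + v) - x₀)
  have hi : Isometry h := by
    refine Isometry.of_dist_eq fun x y => ?_
    simp only [h, dist_smul₀, dist_sub_right, hg, dist_add_left]
    rw [Real.norm_eq_abs, abs_of_pos (inv_pos.2 hc)]
    field_simp
  have h0 : h 0 = 0 := by simp [h, hx]
  let A := hi.affineIsometryOfStrictConvexSpace.linearIsometry
  have hA : ∀ v, A v = h v := by
    intro v
    have := hi.affineIsometryOfStrictConvexSpace.map_vadd 0 v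
    simp [h0] at this
    simpa [A] using this.symm
  refine ⟨A, ?_, fun v => ?_⟩
  · exact (LinearMap.injective_iff_surjective (f := A.toLinearMap)).1 A.injective
  · rw [hA]; simp only [h]; rw [smul_smul, mul_inv_cancel₀ hc.ne', one_smul]; abel

theorem recur {F : Type*} [NormedAddCommGroup F] [InnerProductSpace ℝ F]
    [FiniteDimensional ℝ F] (A : F →ₗᵢ[ℝ] F) (y z : F) (δ : ℝ) (hδ : 0 < δ) :
    ∃ n : ℕ, dist (A^[n+1] y) y < δ ∧ dist (A^[n+1] z) z < δ := by
  have hnorm : ∀ n v, ‖A^[n] v‖ = ‖v‖ := by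
    intro n; induction n with
    | zero => simp
    | succ n ih => intro v; rw [Function.iterate_succ_apply', A.norm_map, ih]
  have hdist : ∀ n u v, dist (A^[n] u) (A^[n] v) = dist u v := by
    intro n; induction n with
    | zero => simp
    | succ n ih => intro u v; rw [Function.iterate_succ_apply', Function.iterate_succ_apply', A.dist_map, ih]
  have : ProperSpace F := FiniteDimensional.proper ℝ F
  obtain ⟨a, _, φ, hφ, hlim⟩ := tendsto_subseq_of_bounded
    (Metric.isBounded_closedBall (x := (0 : F × F)) (r := max ‖y‖ ‖z‖))
    (x := fun n => (A^[n] y, A^[n] z)) (fun n => by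
      rw [mem_closedBall_zero_iff, Prod.norm_def]; simp [hnorm])
  obtain ⟨k, hk⟩ := Metric.cauchySeq_iff.1 hlim.cauchySeq δ hδ
  have h1 := hk (k+1) (by omega) k le_rfl
  have hlt : φ k < φ (k+1) := hφ (by omega)
  obtain ⟨n, hn⟩ := Nat.exists_eq_add_of_lt hlt
  simp only [Function.comp, Prod.dist_eq, max_lt_iff] at h1
  rw [hn, add_assoc, Function.iterate_add_apply A (φ k) (n+1) y,
    Function.iterate_add_apply A (φ k) (n+1) z, hdist, hdist] at h1
  exact ⟨n, h1⟩

theorem no_common {F : Type*} [NormedAddCommGroup F] [InnerProductSpace ℝ F]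
    [FiniteDimensional ℝ F] (g h : F → F) (a b : ℝ) (ha : 0 < a) (hb : 0 < b)
    (hg : ∀ x y, dist (g x) (g y) = a * dist x y) (hh : ∀ x y, dist (h x) (h y) = b * dist x y)
    (V : Set F) (hne : V.Nonempty) (hV : IsOpen V) (hgV : g '' V ⊆ V) (hhV : h '' V ⊆ V)
    (hdis : Disjoint (g '' V) (h '' V)) (x₀ : F) (hgx : g x₀ = x₀) (hhx : h x₀ = x₀) : False := by
  obtain ⟨A, hAs, hA⟩ := sim_linear g a ha hg x₀ hgx
  obtain ⟨B, hBs, hB⟩ := sim_linear h b hb hh x₀ hhx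
  obtain ⟨y', hy'⟩ := hne
  obtain ⟨y, rfl⟩ : ∃ y, y' = x₀ + y := ⟨y' - x₀, by abel⟩
  obtain ⟨δ, hδ, hball⟩ := Metric.isOpen_iff.1 hV _ hy'
  obtain ⟨n, hn1, hn2⟩ := recur A y (B y) (δ / 2) (by positivity)
  obtain ⟨z, hz⟩ := (hBs.comp (hAs.iterate (n+1))) (A^[n+1] (B y))
  simp only [Function.comp] at hz
  have hdist : ∀ n u v, dist (A^[n] u) (A^[n] v) = dist u v := by
    intro n; induction n with
    | zero => simp
    | succ n ih => intro u v; rw [Function.iterate_succ_apply', Function.iterate_succ_apply', A.dist_map, ih]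
  have hzV : x₀ + z ∈ V := by
    apply hball
    rw [Metric.mem_ball, dist_add_left, ← hdist (n+1), ← B.dist_map, hz]
    have := dist_triangle (A^[n+1] (B y)) (B y) (B (A^[n+1] y))
    have h2 : dist (B y) (B (A^[n+1] y)) < δ / 2 := by rw [B.dist_map, dist_comm]; exact hn1
    linarith
  have hit : ∀ k v, g^[k] (x₀ + v) = x₀ + a ^ k • A^[k] v := by
    intro k; induction k with
    | zero => simp
    | succ k ih =>
      intro v
      rw [Function.iterate_succ_apply', ih, hA, map_smul, smul_smul, ← pow_succ',
        Function.iterate_succ_apply']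
  have hitV : ∀ k v, v ∈ V → g^[k] v ∈ V := by
    intro k; induction k with
    | zero => simp
    | succ k ih =>
      intro v hv
      rw [Function.iterate_succ_apply']
      exact hgV ⟨_, ih v hv, rfl⟩
  have e : g (g^[n] (h (x₀ + y))) = h (g^[n+1] (x₀ + z)) := by
    rw [← Function.iterate_succ_apply' g, hB, hit, hit, hB, map_smul, hz]
    have : ∀ k v, A^[k] (b • v) = b • A^[k] v := by
      intro k; induction k with
      | zero => simp
      | succ k ih => intro v; rw [Function.iterate_succ_apply', ih, map_smul, Function.iterate_succ_apply']
    rw [this, smul_comm]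
  exact Set.disjoint_left.1 hdis ⟨_, hitV n _ (hhV ⟨_, hy', rfl⟩), rfl⟩ ⟨_, hitV (n+1) _ hzV, e.symm⟩

theorem sim_fix {F : Type*} [MetricSpace F] [CompleteSpace F] [Nonempty F] (g : F → F) (c : ℝ)
    (hc : 0 < c) (hc1 : c < 1)
    (hg : ∀ x y, dist (g x) (g y) = c * dist x y) : ∃ x, g x = x := by
  have : ContractingWith (⟨c, hc.le⟩ : NNReal) g :=
    ⟨by exact_mod_cast hc1, LipschitzWith.of_dist_le_mul fun x y => (hg x y).le⟩
  exact ⟨_, this.fixedPoint_isFixedPt⟩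

theorem real_sum {F : Type*} [MeasurableSpace F] {M : ℕ} (g : Fin M → F → F)
    (hg : ∀ i, Measurable (g i)) (t : Fin M → ℝ) (ht : ∀ i, 0 < t i) (m : Measure F)
    (hm : IsProbabilityMeasure m) (B : Set F) (hB : MeasurableSet B) :
    (∑ i, ENNReal.ofReal (t i) • m.map (g i)).real B = ∑ i, t i * m.real (g i ⁻¹' B) := by
  rw [Measure.real, Measure.finsetSum_apply, ENNReal.toReal_sum]
  · refine Finset.sum_congr rfl fun i _ => ?_
    rw [Measure.smul_apply, Measure.map_apply (hg i) hB, smul_eq_mul, ENNReal.toReal_mul,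
      ENNReal.toReal_ofReal (ht i).le, Measure.real]
  · intro i _
    rw [Measure.smul_apply, Measure.map_apply (hg i) hB, smul_eq_mul]
    exact ENNReal.mul_ne_top ENNReal.ofReal_ne_top (measure_ne_top _ _)

theorem iter_bound {F : Type*} [MetricSpace F] [MeasurableSpace F] {M : ℕ} (g : Fin M → F → F)
    (hgm : ∀ i, Measurable (g i)) (c : Fin M → ℝ) (ρ : ℝ) (hρ : 0 < ρ) (hρ1 : ρ < 1)
    (hc : ∀ i, ρ ≤ c i) (hg : ∀ i x y, dist (g i x) (g i y) = c i * dist x y)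
    (t : Fin M → ℝ) (ht : ∀ i, 0 < t i) (htsum : ∑ i, t i = 1) (m : Measure F)
    (hν : ∀ B, MeasurableSet B → m.real B = ∑ i, t i * m.real (g i ⁻¹' B)) (i : Fin M) (S : ℝ)
    (n : ℕ) : ∀ (d : ℝ) (B : Set F), 0 < d → MeasurableSet B → DB B d →
      (∀ B', MeasurableSet B' → DB B' (d / ρ ^ n) → m.real B' ≤ S) →
      m.real B ≤ t i ^ n * m.real ((g i)^[n] ⁻¹' B) + (1 - t i ^ n) * S := by
  induction n with
  | zero => intro d B hd hBm hB hS; simp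
  | succ n ih =>
    intro d B hd hBm hB hS
    have e : d / ρ / ρ ^ n = d / ρ ^ (n+1) := by rw [div_div, ← pow_succ']
    have h1 := ih (d / ρ) (g i ⁻¹' B) (by positivity) (hgm i hBm)
      (DB_pre _ _ _ _ hρ (hc i) (hg i) _ hB) (by rw [e]; exact hS)
    have h2 : ∀ j, m.real (g j ⁻¹' B) ≤ S := by
      intro j
      refine hS _ (hgm j hBm) fun x hx y hy => ?_
      refine (DB_pre _ _ _ _ hρ (hc j) (hg j) _ hB x hx y hy).trans ?_
      rw [← e]
      exact le_div_self (by positivity) (by positivity) (pow_le_one₀ hρ.le hρ1.le)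
    have h3 : ∑ j ∈ Finset.univ.erase i, t j * m.real (g j ⁻¹' B)
        ≤ ∑ j ∈ Finset.univ.erase i, t j * S :=
      Finset.sum_le_sum fun j _ => mul_le_mul_of_nonneg_left (h2 j) (ht j).le
    have h4 : ∑ j ∈ Finset.univ.erase i, t j = 1 - t i := by
      rw [← htsum, ← Finset.add_sum_erase _ t (Finset.mem_univ i)]; ring
    rw [← Finset.sum_mul, h4] at h3
    have h5 := mul_le_mul_of_nonneg_left h1 (ht i).le
    rw [hν B hBm, ← Finset.add_sum_erase _ _ (Finset.mem_univ i)]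
    have e2 : (g i)^[n+1] ⁻¹' B = (g i)^[n] ⁻¹' (g i ⁻¹' B) := by
      ext x; simp only [Set.mem_preimage, Function.iterate_succ_apply']
    rw [e2, pow_succ]
    nlinarith

theorem exists_rho {M : ℕ} (c : Fin M → ℝ) (hc : ∀ i, c i ∈ Set.Ioo (0 : ℝ) 1) :
    ∃ ρ, 0 < ρ ∧ ρ < 1 ∧ ∀ i, ρ ≤ c i := by
  rcases isEmpty_or_nonempty (Fin M) with h | h
  · exact ⟨1/2, by norm_num, by norm_num, fun i => h.elim i⟩
  · obtain ⟨i, hi⟩ := Finite.exists_min c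
    exact ⟨c i, (hc i).1, (hc i).2, hi⟩

theorem iter_near {F : Type*} [MetricSpace F] (g : F → F) (c : ℝ)
    (hg : ∀ x y, dist (g x) (g y) = c * dist x y) (x₀ : F) (hx : g x₀ = x₀) (n : ℕ) (z : F) :
    dist (g^[n] z) x₀ = c ^ n * dist z x₀ := by
  induction n with
  | zero => simp
  | succ n ih =>
    rw [Function.iterate_succ_apply']
    nth_rw 1 [← hx]
    rw [hg, ih, pow_succ']; ring

theorem compl_msupport {q : ℕ} (ν : Measure (EuclideanSpace ℝ (Fin q))) :
    ν (msupport ν)ᶜ = 0 := by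
  apply measure_null_of_locally_null
  intro x hx
  simp only [msupport, Set.mem_compl_iff, Set.mem_setOf_eq, not_forall, not_not] at hx
  obtain ⟨U, hU, hxU, h0⟩ := hx
  exact ⟨U, mem_nhdsWithin_of_mem_nhds (hU.mem_nhds hxU), h0⟩

theorem nu_bound {q M : ℕ} (hM : 2 ≤ M)
    (g : Fin M → EuclideanSpace ℝ (Fin q) → EuclideanSpace ℝ (Fin q))
    (c : Fin M → ℝ) (hc : ∀ i, c i ∈ Set.Ioo (0 : ℝ) 1)
    (hg : ∀ i x y, dist (g i x) (g i y) = c i * dist x y)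
    (hOSCg : ∃ V : Set (EuclideanSpace ℝ (Fin q)), V.Nonempty ∧ IsOpen V ∧
      Bornology.IsBounded V ∧
      (∀ i j, i ≠ j → Disjoint (g i '' V) (g j '' V)) ∧
      (⋃ i, g i '' V) ⊆ V)
    (t : Fin M → ℝ) (ht : ∀ i, 0 < t i) (htsum : ∑ i, t i = 1)
    (ν : Measure (EuclideanSpace ℝ (Fin q))) (hνp : IsProbabilityMeasure ν)
    (hν : ν = ∑ i, ENNReal.ofReal (t i) • ν.map (g i))
    (hb : Bornology.IsBounded (msupport ν)) :
    ∃ lam η : ℝ, 0 < lam ∧ 0 < η ∧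
      ∀ d, 0 < d → ∀ B, MeasurableSet B → DB B d → ν.real B ≤ lam * d ^ η := by
  have hgm : ∀ i, Measurable (g i) := fun i => (sim_cont _ _ (hc i).1 (hg i)).measurable
  have hνr : ∀ B, MeasurableSet B → ν.real B = ∑ i, t i * ν.real (g i ⁻¹' B) := by
    intro B hB
    rw [← real_sum g hgm t ht ν hνp B hB, ← hν]
  obtain ⟨ρ, hρ, hρ1, hρc⟩ := exists_rho c hc
  obtain ⟨V, hVne, hVo, -, hVd, hVs⟩ := hOSCg
  have hVs' : ∀ i, g i '' V ⊆ V := fun i => (Set.subset_iUnion (fun i => g i '' V) i).trans hVs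
  let i : Fin M := ⟨0, by omega⟩
  let j : Fin M := ⟨1, by omega⟩
  have hij : i ≠ j := by simp [i, j]
  obtain ⟨x, hx⟩ := sim_fix (g i) (c i) (hc i).1 (hc i).2 (hg i)
  obtain ⟨y, hy⟩ := sim_fix (g j) (c j) (hc j).1 (hc j).2 (hg j)
  have hxy : x ≠ y := by
    rintro rfl
    exact no_common (g i) (g j) (c i) (c j) (hc i).1 (hc j).1 (hg i) (hg j) V hVne hVo (hVs' i)
      (hVs' j) (hVd i j hij) x hx hy
  set D := dist x y with hD
  have hD0 : 0 < D := dist_pos.2 hxy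
  obtain ⟨R₁, hR₁⟩ := hb.subset_closedBall x
  obtain ⟨R₂, hR₂⟩ := hb.subset_closedBall y
  let R := max 1 (max R₁ R₂)
  have hR0 : 0 < R := lt_of_lt_of_le one_pos (le_max_left _ _)
  have hRx : ∀ z ∈ msupport ν, dist z x ≤ R := fun z hz =>
    (hR₁ hz).trans ((le_max_left _ _).trans (le_max_right _ _))
  have hRy : ∀ z ∈ msupport ν, dist z y ≤ R := fun z hz =>
    (hR₂ hz).trans ((le_max_right _ _).trans (le_max_right _ _))
  obtain ⟨n, hni, hnj⟩ : ∃ n, c i ^ n < D / 4 / R ∧ c j ^ n < D / 4 / R := by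
    have h := fun k => (tendsto_pow_atTop_nhds_zero_of_lt_one (hc k).1.le (hc k).2).eventually
      (gt_mem_nhds (show 0 < D / 4 / R by positivity))
    exact ((h i).and (h j)).exists
  rw [lt_div_iff₀ hR0] at hni hnj
  have ht1 : ∀ k, t k ≤ 1 := fun k => by
    rw [← htsum]; exact Finset.single_le_sum (fun k _ => (ht k).le) (Finset.mem_univ k)
  have hmin : 0 < min (t i ^ n) (t j ^ n) := lt_min (pow_pos (ht i) n) (pow_pos (ht j) n)
  have hmin1 : min (t i ^ n) (t j ^ n) ≤ 1 := (min_le_left _ _).trans (pow_le_one₀ (ht i).le (ht1 i))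
  rcases Nat.eq_zero_or_pos n with hn0 | hn0
  · exfalso
    subst hn0
    have : (msupport ν).Nonempty := by
      by_contra hne
      rw [Set.not_nonempty_iff_eq_empty] at hne
      have := compl_msupport ν
      rw [hne, Set.compl_empty, measure_univ] at this
      exact one_ne_zero this
    obtain ⟨z, hz⟩ := this
    have h1 := hRx z hz
    have h2 := hRy z hz
    have h3 := dist_triangle_left x y z
    simp at hni hnj
    linarith
  refine final_lemma ν hνp 0 1 (1 - min (t i ^ n) (t j ^ n)) (ρ ^ n) (D / 2) le_rfl one_pos
    (by linarith) (by linarith) (by positivity) (pow_lt_one₀ hρ.le hρ1 hn0.ne') (by positivity) ?_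
  intro d hd hdD S hS hSB B hBm hB
  have hk : ∀ k, ν.real ((g k)^[n] ⁻¹' B) = 0 → min (t i ^ n) (t j ^ n) ≤ t k ^ n →
      ν.real B ≤ 0 * d ^ (1:ℝ) + (1 - min (t i ^ n) (t j ^ n)) * S := by
    intro k hk hmk
    have := iter_bound g hgm c ρ hρ hρ1 hρc hg t ht htsum ν hνr k S n d B hd hBm hB hSB
    rw [hk] at this
    nlinarith
  by_cases hi : ν.real ((g i)^[n] ⁻¹' B) = 0
  · exact hk i hi (min_le_left _ _)
  by_cases hj : ν.real ((g j)^[n] ⁻¹' B) = 0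
  · exact hk j hj (min_le_right _ _)
  exfalso
  have hex : ∀ A : Set (EuclideanSpace ℝ (Fin q)), ν.real A ≠ 0 → ∃ z ∈ msupport ν, z ∈ A := by
    intro A hA
    by_contra hcon
    push Not at hcon
    apply hA
    have : ν A = 0 := measure_mono_null (fun z hz => fun hz' => hcon z hz' hz) (compl_msupport ν)
    simp [Measure.real, this]
  obtain ⟨z, hz, hzB⟩ := hex _ hi
  obtain ⟨w, hw, hwB⟩ := hex _ hj
  have h1 := hB _ hzB _ hwB
  have h2 := iter_near (g i) (c i) (hg i) x hx n z
  have h3 := iter_near (g j) (c j) (hg j) y hy n w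
  have h4 := mul_le_mul_of_nonneg_left (hRx z hz) (pow_nonneg (hc i).1.le n)
  have h5 := mul_le_mul_of_nonneg_left (hRy w hw) (pow_nonneg (hc j).1.le n)
  have h6 := dist_triangle4 x ((g i)^[n] z) ((g j)^[n] w) y
  rw [dist_comm x ((g i)^[n] z)] at h6
  linarith

theorem stmt3 (q N M : ℕ) (hq : 1 ≤ q) (hN : 2 ≤ N) (hM : 2 ≤ M)
    (f : Fin N → EuclideanSpace ℝ (Fin q) → EuclideanSpace ℝ (Fin q))
    (s : Fin N → ℝ) (hs : ∀ i, s i ∈ Set.Ioo (0 : ℝ) 1)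
    (hf : ∀ i x y, dist (f i x) (f i y) = s i * dist x y)
    (hOSCf : ∃ V : Set (EuclideanSpace ℝ (Fin q)), V.Nonempty ∧ IsOpen V ∧
      Bornology.IsBounded V ∧
      (∀ i j, i ≠ j → Disjoint (f i '' V) (f j '' V)) ∧
      (⋃ i, f i '' V) ⊆ V)
    (E : Set (EuclideanSpace ℝ (Fin q))) (hEc : IsCompact E) (hEne : E.Nonempty)
    (hE : E = ⋃ i, f i '' E)
    (g : Fin M → EuclideanSpace ℝ (Fin q) → EuclideanSpace ℝ (Fin q))
    (c : Fin M → ℝ) (hc : ∀ i, c i ∈ Set.Ioo (0 : ℝ) 1)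
    (hg : ∀ i x y, dist (g i x) (g i y) = c i * dist x y)
    (hOSCg : ∃ V : Set (EuclideanSpace ℝ (Fin q)), V.Nonempty ∧ IsOpen V ∧
      Bornology.IsBounded V ∧
      (∀ i j, i ≠ j → Disjoint (g i '' V) (g j '' V)) ∧
      (⋃ i, g i '' V) ⊆ V)
    (t : Fin M → ℝ) (ht : ∀ i, 0 < t i) (htsum : ∑ i, t i = 1)
    (ν : Measure (EuclideanSpace ℝ (Fin q))) (hνp : IsProbabilityMeasure ν)
    (hν : ν = ∑ i, ENNReal.ofReal (t i) • ν.map (g i))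
    (C : Set (EuclideanSpace ℝ (Fin q))) (hC : C = msupport ν)
    (p : Fin (N + 1) → ℝ) (hp : ∀ i, 0 < p i) (hpsum : ∑ i, p i = 1)
    (μ : Measure (EuclideanSpace ℝ (Fin q))) (hμp : IsProbabilityMeasure μ)
    (hμ : μ = ENNReal.ofReal (p 0) • ν + ∑ i : Fin N, ENNReal.ofReal (p i.succ) • μ.map (f i))
    -- the in-homogeneous open set condition
    (U : Set (EuclideanSpace ℝ (Fin q))) (hUne : U.Nonempty) (hUo : IsOpen U)
    (hUb : Bornology.IsBounded U)
    (hIOSC1 : ∀ i, f i '' U ⊆ U)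
    (hIOSC2 : ∀ i j, i ≠ j → Disjoint (f i '' U) (f j '' U))
    (hIOSC3 : (E ∩ U).Nonempty ∧ C ⊆ U)
    (hIOSC4 : ν (frontier U) = 0 ∧ ∀ i, C ∩ (f i '' closure U) = ∅) :
    ∃ lam : ℝ, 0 < lam ∧ ∃ eta : ℝ, 0 < eta ∧
      ∀ (x : EuclideanSpace ℝ (Fin q)) (ε : ℝ), 0 < ε →
        μ (closedBall x ε) ≤ ENNReal.ofReal (lam * ε ^ eta) := by
  have hfm : ∀ i, Measurable (f i) := fun i => (sim_cont _ _ (hs i).1 (hf i)).measurable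
  obtain ⟨K, a, hK, ha, hνb⟩ := nu_bound hM g c hc hg hOSCg t ht htsum ν hνp hν
    (hUb.subset (hC ▸ hIOSC3.2))
  obtain ⟨ρ, hρ, hρ1, hρs⟩ := exists_rho s hs
  rw [Fin.sum_univ_succ] at hpsum
  have hp0 := hp 0
  have hsum0 : 0 ≤ ∑ i : Fin N, p i.succ := Finset.sum_nonneg fun i _ => (hp _).le
  have hμr : ∀ B, MeasurableSet B → μ.real B =
      p 0 * ν.real B + ∑ i : Fin N, p i.succ * μ.real (f i ⁻¹' B) := by
    intro B hB
    rw [← real_sum f hfm (fun i => p i.succ) (fun i => hp _) μ hμp B hB]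
    have h1 : μ B = (ENNReal.ofReal (p 0) • ν
      + ∑ i : Fin N, ENNReal.ofReal (p i.succ) • μ.map (f i)) B := by rw [← hμ]
    rw [Measure.add_apply, Measure.smul_apply, smul_eq_mul] at h1
    have hfin : (∑ i : Fin N, ENNReal.ofReal (p i.succ) • μ.map (f i)) B ≠ ⊤ := by
      intro htop
      rw [htop, add_top] at h1
      exact measure_ne_top μ B h1
    rw [Measure.real, h1, ENNReal.toReal_add
      (ENNReal.mul_ne_top ENNReal.ofReal_ne_top (measure_ne_top _ _)) hfin,
      ENNReal.toReal_mul, ENNReal.toReal_ofReal hp0.le]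
    rfl
  obtain ⟨lam, η, hlam, hη, h⟩ := final_lemma μ hμp (p 0 * K) a (∑ i : Fin N, p i.succ) ρ 1
    (by positivity) ha hsum0 (by linarith) hρ hρ1 one_pos (by
      intro d hd _ S hS hSB B hBm hB
      rw [hμr B hBm, Finset.sum_mul, mul_assoc]
      exact add_le_add (mul_le_mul_of_nonneg_left (hνb d hd B hBm hB) hp0.le)
        (Finset.sum_le_sum fun i _ => mul_le_mul_of_nonneg_left
          (hSB _ (hfm i hBm) (DB_pre _ _ _ _ hρ (hρs i) (hf i) _ hB)) (hp _).le))
  refine ⟨lam * 2 ^ η, by positivity, η, hη, fun x ε hε => ?_⟩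
  have h1 := h (2 * ε) (by positivity) (closedBall x ε) measurableSet_closedBall (by
    intro y hy z hz
    have := dist_triangle_right y z x
    rw [mem_closedBall] at hy hz
    linarith)
  rw [Real.mul_rpow (by norm_num) hε.le, ← mul_assoc] at h1
  rw [← ENNReal.ofReal_toReal (measure_ne_top μ (closedBall x ε))]
  exact ENNReal.ofReal_le_ofReal h1
end

section
/- D̲₀(ν) ≤ D̲₀(μ) ≤ D̄₀(μ) ≤ D̄₀(ν). In particular, if the quantization dimension D₀(ν) of order zero exists and equals d₀, then D₀(μ) exists and equals d₀; moreover, if in addition Q̲₀^{d₀}(ν) > 0, then Q̲₀^{d₀}(μ) > 0. -/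
open MeasureTheory Filter Metric

/-- The `n`-th geometric mean error (quantization error of order zero) of a Borel
probability measure `P` on `ℝ^q`. -/
noncomputable def geomError {q : ℕ} (P : Measure (EuclideanSpace ℝ (Fin q))) (n : ℕ) : ℝ :=
  sInf {r : ℝ | ∃ α : Finset (EuclideanSpace ℝ (Fin q)), α.Nonempty ∧ α.card ≤ n ∧
    r = Real.exp (∫ x, Real.log (infDist x (↑α : Set (EuclideanSpace ℝ (Fin q)))) ∂P)}


lemma seq_part1 (u v : ℕ → ℝ) (c : ℝ)
    (H1 : ∀ n, 1 ≤ n → -v n ≤ -u n + c)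
    (hu : Tendsto (fun n => -u n) atTop atTop) (hv : Tendsto (fun n => -v n) atTop atTop)
    (bu : IsBoundedUnder (· ≥ ·) atTop (fun n : ℕ => Real.log n / (-u n)))
    (bv : IsBoundedUnder (· ≤ ·) atTop (fun n : ℕ => Real.log n / (-v n))) :
    liminf (fun n : ℕ => Real.log n / (-u n)) atTop ≤
      liminf (fun n : ℕ => Real.log n / (-v n)) atTop := by
  refine le_of_forall_lt fun a ha => ?_
  obtain ⟨b, hab, hb⟩ := exists_between ha
  obtain ⟨a', haa', hab'⟩ := exists_between hab
  refine lt_of_lt_of_le haa' ?_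
  refine le_liminf_of_le bv.isCoboundedUnder_ge ?_
  have h1 := eventually_lt_of_lt_liminf hb bu
  filter_upwards [h1, hu.eventually_gt_atTop 0, hv.eventually_gt_atTop 0,
    hv.eventually_ge_atTop (b * c / (b - a')), eventually_ge_atTop 1] with n h1 h2 h3 h4 h5
  rw [lt_div_iff₀ h2] at h1
  rw [le_div_iff₀ h3]
  have hlog : 0 ≤ Real.log n := Real.log_natCast_nonneg n
  rw [div_le_iff₀ (by linarith)] at h4
  have h6 := H1 n h5
  rcases le_or_gt 0 b with hb0 | hb0
  · nlinarith [mul_le_mul_of_nonneg_left h6 hb0]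
  · nlinarith

lemma log_div_tendsto (M : ℕ) (hM : 1 ≤ M) :
    Tendsto (fun n : ℕ => Real.log ((n / M : ℕ) : ℝ) / Real.log n) atTop (nhds 1) := by
  have hl : Tendsto (fun n : ℕ => Real.log n) atTop atTop :=
    Real.tendsto_log_atTop.comp tendsto_natCast_atTop_atTop
  have h0 : Tendsto (fun n : ℕ => 1 - Real.log (2 * M) / Real.log n) atTop (nhds (1 - 0)) :=
    tendsto_const_nhds.sub (hl.const_div_atTop _)
  rw [sub_zero] at h0
  refine tendsto_of_tendsto_of_tendsto_of_le_of_le' h0 tendsto_const_nhds ?_ ?_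
  · filter_upwards [hl.eventually_gt_atTop 0, eventually_ge_atTop M] with n hn hnM
    have hM' : (1:ℝ) ≤ M := by exact_mod_cast hM
    have hk : 1 ≤ n / M := (Nat.one_le_div_iff (by omega)).2 hnM
    have h1 : n ≤ 2 * M * (n / M) := by
      have h2 := Nat.div_add_mod n M
      have h3 := Nat.mod_lt n (show M > 0 by omega)
      nlinarith
    have h1' : (n:ℝ) ≤ 2 * M * ((n / M : ℕ) : ℝ) := by exact_mod_cast h1
    have hk' : (1:ℝ) ≤ ((n / M : ℕ) : ℝ) := by exact_mod_cast hk
    have hn0 : (0:ℝ) < n := by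
      have : 0 < n := by omega
      exact_mod_cast this
    have h4 := Real.log_le_log hn0 h1'
    rw [Real.log_mul (by positivity) (by positivity)] at h4
    rw [sub_le_iff_le_add, ← add_div, le_div_iff₀ hn]
    linarith
  · filter_upwards [hl.eventually_gt_atTop 0, eventually_ge_atTop M] with n hn hnM
    rw [div_le_one hn]
    have hk : 1 ≤ n / M := (Nat.one_le_div_iff (by omega)).2 hnM
    have hk' : (0:ℝ) < ((n / M : ℕ) : ℝ) := by exact_mod_cast hk
    apply Real.log_le_log hk'
    exact_mod_cast Nat.div_le_self n M

lemma seq_part3 (u v : ℕ → ℝ) (M : ℕ) (hM : 1 ≤ M) (p : ℝ) (hp : 0 < p) (hp1 : p < 1)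
    (H2 : ∀ m, 1 ≤ m → v (M * m) ≤ p * u m + (1 - p) * v m)
    (H3 : ∀ m n, 1 ≤ m → m ≤ n → v n ≤ v m)
    (hu : Tendsto (fun n => -u n) atTop atTop) (hv : Tendsto (fun n => -v n) atTop atTop)
    (bu : IsBoundedUnder (· ≤ ·) atTop (fun n : ℕ => Real.log n / (-u n)))
    (bv : IsBoundedUnder (· ≥ ·) atTop (fun n : ℕ => Real.log n / (-v n)))
    (bA : IsBoundedUnder (· ≤ ·) atTop (fun n : ℕ => (-v n) / Real.log n)) :
    limsup (fun n : ℕ => Real.log n / (-v n)) atTop ≤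
      limsup (fun n : ℕ => Real.log n / (-u n)) atTop := by
  have hl : Tendsto (fun n : ℕ => Real.log n) atTop atTop :=
    Real.tendsto_log_atTop.comp tendsto_natCast_atTop_atTop
  refine le_of_forall_gt fun c1 hc1 => ?_
  obtain ⟨c2, hc2, hc21⟩ := exists_between hc1
  obtain ⟨c, hc, hc2c⟩ := exists_between hc2
  refine lt_of_le_of_lt ?_ hc21
  have e1 := eventually_lt_of_limsup_lt hc bu
  have hc0 : 0 < c := by
    obtain ⟨n, h1, h2, h3⟩ := (e1.and ((hu.eventually_gt_atTop 0).and
      (hl.eventually_gt_atTop 0))).exists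
    exact lt_trans (div_pos h3 h2) h1
  have bB : IsBoundedUnder (· ≥ ·) atTop (fun n : ℕ => (-v n) / Real.log n) := by
    refine isBoundedUnder_of_eventually_ge (a := 0) ?_
    filter_upwards [hv.eventually_gt_atTop 0, hl.eventually_gt_atTop 0] with n h1 h2
    positivity
  set A := liminf (fun n : ℕ => (-v n) / Real.log n) atTop with hA
  have key : ∀ t < A, p / c + (1 - p) * t ≤ A := by
    intro t ht
    have ht1 := eventually_lt_of_lt_liminf ht bB
    have hdiv : Tendsto (fun n : ℕ => n / M) atTop atTop := Nat.tendsto_div_const_atTop (by omega)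
    have hw := (log_div_tendsto M hM).const_mul (p / c + (1 - p) * t)
    rw [mul_one] at hw
    rw [← hw.liminf_eq]
    refine liminf_le_liminf ?_ hw.isBoundedUnder_ge bA.isCoboundedUnder_ge
    filter_upwards [hdiv.eventually ht1, hdiv.eventually e1,
      hdiv.eventually (hu.eventually_gt_atTop 0), hdiv.eventually (hl.eventually_gt_atTop 0),
      hdiv.eventually_ge_atTop 1, hl.eventually_gt_atTop 0] with n g1 g2 g3 g4 g5 g6
    rw [lt_div_iff₀ g4] at g1
    rw [div_lt_iff₀ g3] at g2
    have g7 := H2 _ g5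
    have g8 := H3 (M * (n / M)) n (by nlinarith) (Nat.mul_div_le n M)
    rw [mul_div_assoc']
    gcongr
    have g9 : Real.log ((n / M : ℕ) : ℝ) / c ≤ - u (n / M) := by
      rw [div_le_iff₀ hc0]; linarith
    have g10 : (p / c + (1 - p) * t) * Real.log ((n / M : ℕ) : ℝ) =
      p * (Real.log ((n / M : ℕ) : ℝ) / c) + (1 - p) * (t * Real.log ((n / M : ℕ) : ℝ)) := by ring
    rw [g10]
    nlinarith [mul_le_mul_of_nonneg_left g9 hp.le,
      mul_le_mul_of_nonneg_left g1.le (show 0 ≤ 1 - p by linarith)]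
  have hA1 : 1 / c ≤ A := by
    have : p / c + (1 - p) * A ≤ A := by
      refine le_of_forall_pos_le_add fun ε hε => ?_
      have := key (A - ε) (by linarith)
      nlinarith
    rw [div_le_iff₀ hc0]
    have h2 : p / c ≤ p * A := by linarith
    rw [div_le_iff₀ hc0] at h2
    nlinarith
  have hA2 : 1 / c2 < A := lt_of_lt_of_le (one_div_lt_one_div_of_lt hc0 hc2c) hA1
  have hc20 : 0 < c2 := by linarith
  refine limsup_le_of_le bv.isCoboundedUnder_le ?_
  filter_upwards [eventually_lt_of_lt_liminf hA2 bB, hv.eventually_gt_atTop 0,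
    hl.eventually_gt_atTop 0] with n h1 h2 h3
  rw [lt_div_iff₀ h3, div_mul_eq_mul_div, one_mul, div_lt_iff₀ hc20] at h1
  rw [div_le_iff₀ h2]
  linarith

lemma seq_bounds (u : ℕ → ℝ) (c C c' C' : ℝ) (hc : 0 < c)
    (h1 : ∀ n : ℕ, 1 ≤ n → u n ≤ C - c * Real.log n)
    (h2 : ∀ n : ℕ, 1 ≤ n → C' - c' * Real.log n ≤ u n) :
    Tendsto (fun n => -u n) atTop atTop ∧
    IsBoundedUnder (· ≤ ·) atTop (fun n : ℕ => Real.log n / (-u n)) ∧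
    IsBoundedUnder (· ≥ ·) atTop (fun n : ℕ => Real.log n / (-u n)) ∧
    IsBoundedUnder (· ≤ ·) atTop (fun n : ℕ => (-u n) / Real.log n) := by
  have hl : Tendsto (fun n : ℕ => Real.log n) atTop atTop :=
    Real.tendsto_log_atTop.comp tendsto_natCast_atTop_atTop
  have hu : Tendsto (fun n => -u n) atTop atTop := by
    have : Tendsto (fun n : ℕ => -C + c * Real.log n) atTop atTop :=
      tendsto_atTop_add_const_left _ _ (hl.const_mul_atTop hc)
    refine tendsto_atTop_mono' _ ?_ this
    filter_upwards [eventually_ge_atTop 1] with n hn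
    linarith [h1 n hn]
  refine ⟨hu, ?_, ?_, ?_⟩
  · refine isBoundedUnder_of_eventually_le (a := 2 / c) ?_
    filter_upwards [eventually_ge_atTop 1, hu.eventually_gt_atTop 0,
      hl.eventually_ge_atTop (2 * C / c)] with n a1 a2 a3
    rw [div_le_iff₀ a2, div_mul_eq_mul_div, le_div_iff₀ hc]
    rw [div_le_iff₀ hc] at a3
    linarith [h1 n a1]
  · refine isBoundedUnder_of_eventually_ge (a := 0) ?_
    filter_upwards [hu.eventually_gt_atTop 0, hl.eventually_ge_atTop 0] with n a1 a2
    positivity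
  · refine isBoundedUnder_of_eventually_le (a := c' + 1) ?_
    filter_upwards [eventually_ge_atTop 1, hl.eventually_gt_atTop 0,
      hl.eventually_ge_atTop (-C')] with n a1 a2 a3
    rw [div_le_iff₀ a2]
    linarith [h2 n a1]


section
variable {q : ℕ} {P : Measure (EuclideanSpace ℝ (Fin q))} {lam eta : ℝ}

lemma null_singleton (heta : 0 < eta)
    (hball : ∀ (x : EuclideanSpace ℝ (Fin q)) (ε : ℝ), 0 < ε →
      P (closedBall x ε) ≤ ENNReal.ofReal (lam * ε ^ eta)) (a : EuclideanSpace ℝ (Fin q)) :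
    P {a} = 0 := by
  have h1 : Tendsto (fun ε : ℝ => ENNReal.ofReal (lam * ε ^ eta)) (nhdsWithin 0 (Set.Ioi 0))
      (nhds (ENNReal.ofReal (lam * 0 ^ eta))) := by
    refine ENNReal.tendsto_ofReal (Tendsto.const_mul _ ?_)
    exact ((Real.continuousAt_rpow_const 0 eta (Or.inr heta.le)).tendsto).mono_left
      nhdsWithin_le_nhds
  rw [Real.zero_rpow heta.ne', mul_zero, ENNReal.ofReal_zero] at h1
  refine le_antisymm (ge_of_tendsto h1 ?_) bot_le
  filter_upwards [self_mem_nhdsWithin] with ε hε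
  refine le_trans (measure_mono ?_) (hball a ε hε)
  simpa using le_of_lt hε

lemma ae_pos (heta : 0 < eta)
    (hball : ∀ (x : EuclideanSpace ℝ (Fin q)) (ε : ℝ), 0 < ε →
      P (closedBall x ε) ≤ ENNReal.ofReal (lam * ε ^ eta))
    (α : Finset (EuclideanSpace ℝ (Fin q))) (hα : α.Nonempty) :
    ∀ᵐ x ∂P, 0 < infDist x (α : Set (EuclideanSpace ℝ (Fin q))) := by
  have h0 : P (α : Set (EuclideanSpace ℝ (Fin q))) = 0 := by
    rw [← Set.biUnion_of_singleton (α : Set (EuclideanSpace ℝ (Fin q)))]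
    exact (measure_biUnion_null_iff α.countable_toSet).2
      fun a _ => null_singleton heta hball a
  have h1 := (measure_eq_zero_iff_ae_notMem).1 h0
  filter_upwards [h1] with x hx
  exact (α.finite_toSet.isClosed.notMem_iff_infDist_pos (by simpa using hα)).1 hx

lemma moment [IsProbabilityMeasure P] (hlam : 0 < lam) (heta : 0 < eta)
    (hball : ∀ (x : EuclideanSpace ℝ (Fin q)) (ε : ℝ), 0 < ε →
      P (closedBall x ε) ≤ ENNReal.ofReal (lam * ε ^ eta)) (a : EuclideanSpace ℝ (Fin q)) :
    Integrable (fun x => dist x a ^ (-(eta / 2))) P ∧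
      ∫ x, dist x a ^ (-(eta / 2)) ∂P ≤ 1 + lam := by
  have hm : Measurable (fun x => dist x a ^ (-(eta / 2))) :=
    (measurable_id.dist measurable_const).pow_const _
  have hnn : ∀ x : EuclideanSpace ℝ (Fin q), 0 ≤ dist x a ^ (-(eta / 2)) := fun x =>
    Real.rpow_nonneg dist_nonneg _
  have hl : ∫⁻ x, ENNReal.ofReal (dist x a ^ (-(eta / 2))) ∂P ≤ ENNReal.ofReal (1 + lam) := by
    rw [lintegral_eq_lintegral_meas_le P (Eventually.of_forall hnn) hm.aemeasurable]
    have hU : Set.Ioi (0:ℝ) = Set.Ioc 0 1 ∪ Set.Ioi 1 :=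
      (Set.Ioc_union_Ioi_eq_Ioi zero_le_one).symm
    rw [hU, ENNReal.ofReal_add zero_le_one hlam.le]
    refine (lintegral_union_le _ _ _).trans (add_le_add ?_ ?_)
    · refine (lintegral_mono (g := fun _ => 1) fun t => prob_le_one).trans ?_
      simp
    · have hint : ∫⁻ t in Set.Ioi (1:ℝ), ENNReal.ofReal (lam * t ^ (-2:ℝ)) = ENNReal.ofReal lam := by
        rw [← ofReal_integral_eq_lintegral_ofReal]
        · rw [integral_const_mul, integral_Ioi_rpow_of_lt (by norm_num) one_pos]
          norm_num
        · exact (integrableOn_Ioi_rpow_of_lt (by norm_num) one_pos).const_mul _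
        · filter_upwards [ae_restrict_mem measurableSet_Ioi] with t ht
          have : (0:ℝ) < t := lt_trans one_pos ht
          positivity
      rw [← hint]
      refine setLIntegral_mono_ae' measurableSet_Ioi (Eventually.of_forall fun t ht => ?_)
      have ht0 : (0:ℝ) < t := lt_trans one_pos ht
      have hb := hball a (t ^ (-(2 / eta))) (Real.rpow_pos_of_pos ht0 _)
      rw [← Real.rpow_mul ht0.le, show -(2 / eta) * eta = -2 by field_simp] at hb
      refine (measure_mono ?_).trans hb
      intro x hx
      simp only [Set.mem_ofPred_eq] at hx
      rw [mem_closedBall]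
      rcases (dist_nonneg (x := x) (y := a)).eq_or_lt with h | h
      · rw [← h]; positivity
      · have h2 := Real.rpow_le_rpow_of_nonpos ht0 hx (z := -(2/eta))
          (by have : 0 < 2 / eta := by positivity
              linarith)
        rwa [← Real.rpow_mul h.le, show -(eta / 2) * -(2 / eta) = 1 by field_simp,
          Real.rpow_one] at h2
  have hi : Integrable (fun x => dist x a ^ (-(eta / 2))) P := by
    refine ⟨hm.aestronglyMeasurable, ?_⟩
    rw [hasFiniteIntegral_iff_ofReal (Eventually.of_forall hnn)]
    exact hl.trans_lt ENNReal.ofReal_lt_top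
  refine ⟨hi, ?_⟩
  rw [integral_eq_lintegral_of_nonneg_ae (Eventually.of_forall hnn) hm.aestronglyMeasurable]
  exact ENNReal.toReal_le_of_le_ofReal (by linarith) hl

lemma rpow_le_sum (α : Finset (EuclideanSpace ℝ (Fin q))) (hα : α.Nonempty)
    (z : ℝ) (x : EuclideanSpace ℝ (Fin q)) :
    infDist x (α : Set (EuclideanSpace ℝ (Fin q))) ^ z ≤ ∑ a ∈ α, dist x a ^ z := by
  obtain ⟨a, ha, h⟩ := α.finite_toSet.isCompact.exists_infDist_eq_dist (by simpa using hα) x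
  rw [h]
  exact Finset.single_le_sum (f := fun a => dist x a ^ z)
    (fun i _ => Real.rpow_nonneg dist_nonneg _) (by simpa using ha)

lemma log_integrable [IsProbabilityMeasure P] (hlam : 0 < lam) (heta : 0 < eta)
    (hball : ∀ (x : EuclideanSpace ℝ (Fin q)) (ε : ℝ), 0 < ε →
      P (closedBall x ε) ≤ ENNReal.ofReal (lam * ε ^ eta))
    (hc : ∃ K : Set (EuclideanSpace ℝ (Fin q)), IsCompact K ∧ P Kᶜ = 0)
    (α : Finset (EuclideanSpace ℝ (Fin q))) (hα : α.Nonempty) :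
    Integrable (fun x => Real.log (infDist x (α : Set (EuclideanSpace ℝ (Fin q))))) P := by
  obtain ⟨K, hK, hPK⟩ := hc
  obtain ⟨a, ha⟩ := id hα
  obtain ⟨R, hR⟩ := (isBounded_iff_subset_closedBall a).1 hK.isBounded
  have hsum : Integrable (fun x => 2 / eta * ∑ b ∈ α, dist x b ^ (-(eta / 2)) + R) P :=
    ((integrable_finsetSum _ fun b _ => (moment hlam heta hball b).1).const_mul _).add
      (integrable_const _)
  refine hsum.mono' (Real.measurable_log.comp measurable_infDist).aestronglyMeasurable ?_
  have hmem : ∀ᵐ x ∂P, x ∈ K := by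
    rw [ae_iff]; exact hPK
  filter_upwards [hmem, ae_pos heta hball α hα] with x hx hpos
  have h1 : infDist x (α : Set (EuclideanSpace ℝ (Fin q))) ≤ R :=
    (infDist_le_dist_of_mem (by simpa using ha)).trans (by simpa using hR hx)
  have h2 := rpow_le_sum α hα (-(eta / 2)) x
  have h0 := infDist_nonneg (x := x) (s := (α : Set (EuclideanSpace ℝ (Fin q))))
  set d := infDist x (α : Set (EuclideanSpace ℝ (Fin q)))
  have h3 := Real.log_le_sub_one_of_pos hpos
  have h4 := Real.log_le_sub_one_of_pos (Real.rpow_pos_of_pos hpos (-(eta / 2)))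
  rw [Real.log_rpow hpos] at h4
  have h5 : 0 ≤ d ^ (-(eta / 2)) := Real.rpow_nonneg h0 _
  have h6 : 2 / eta * d ^ (-(eta / 2)) ≤ 2 / eta * ∑ b ∈ α, dist x b ^ (-(eta / 2)) := by gcongr
  have h7 : - Real.log d ≤ 2 / eta * d ^ (-(eta / 2)) := by
    rw [div_mul_eq_mul_div, le_div_iff₀ heta]; linarith
  have h8 : 0 ≤ 2 / eta * d ^ (-(eta / 2)) := by positivity
  rw [Real.norm_eq_abs, abs_le]
  constructor <;> linarith

lemma log_int_lower [IsProbabilityMeasure P] (hlam : 0 < lam) (heta : 0 < eta)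
    (hball : ∀ (x : EuclideanSpace ℝ (Fin q)) (ε : ℝ), 0 < ε →
      P (closedBall x ε) ≤ ENNReal.ofReal (lam * ε ^ eta))
    (hc : ∃ K : Set (EuclideanSpace ℝ (Fin q)), IsCompact K ∧ P Kᶜ = 0)
    (α : Finset (EuclideanSpace ℝ (Fin q))) (hα : α.Nonempty) :
    -(2 / eta * Real.log (1 + lam)) - 2 / eta * Real.log α.card ≤
      ∫ x, Real.log (infDist x (α : Set (EuclideanSpace ℝ (Fin q)))) ∂P := by
  have hcard : (0:ℝ) < α.card := by exact_mod_cast hα.card_pos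
  set C : ℝ := α.card * (1 + lam) with hC
  have hC0 : 0 < C := by positivity
  have hsI : Integrable (fun x => ∑ b ∈ α, dist x b ^ (-(eta / 2))) P :=
    integrable_finsetSum _ fun b _ => (moment hlam heta hball b).1
  have hsum : ∫ x, ∑ b ∈ α, dist x b ^ (-(eta / 2)) ∂P ≤ C := by
    rw [integral_finsetSum _ fun b _ => (moment hlam heta hball b).1]
    refine (Finset.sum_le_card_nsmul _ _ _ fun b _ => (moment hlam heta hball b).2).trans ?_
    rw [nsmul_eq_mul]
  have hI := log_integrable hlam heta hball hc α hα
  have hle : ∫ x, (2 / eta) * (1 - Real.log C - C⁻¹ * ∑ b ∈ α, dist x b ^ (-(eta / 2))) ∂P ≤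
      ∫ x, Real.log (infDist x (α : Set (EuclideanSpace ℝ (Fin q)))) ∂P := by
    refine integral_mono_ae (((integrable_const _).sub (hsI.const_mul _)).const_mul _) hI ?_
    filter_upwards [ae_pos heta hball α hα] with x hpos
    have h2 := rpow_le_sum α hα (-(eta / 2)) x
    set d := infDist x (α : Set (EuclideanSpace ℝ (Fin q)))
    have hdp := Real.rpow_pos_of_pos hpos (-(eta / 2))
    have h4 := Real.log_le_sub_one_of_pos (mul_pos (inv_pos.2 hC0) hdp)
    rw [Real.log_mul (by positivity) (by positivity), Real.log_rpow hpos, Real.log_inv] at h4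
    have h5 : C⁻¹ * d ^ (-(eta / 2)) ≤ C⁻¹ * ∑ b ∈ α, dist x b ^ (-(eta / 2)) := by gcongr
    rw [div_mul_eq_mul_div, div_le_iff₀ heta]
    linarith
  refine le_trans ?_ hle
  rw [integral_const_mul, integral_sub (integrable_const _) (hsI.const_mul _), integral_const_mul]
  simp only [integral_const, probReal_univ, one_smul]
  have h6 : C⁻¹ * ∫ x, ∑ b ∈ α, dist x b ^ (-(eta / 2)) ∂P ≤ 1 := by
    rw [inv_mul_le_iff₀ hC0]; linarith
  have h7 : Real.log C = Real.log α.card + Real.log (1 + lam) := by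
    rw [hC, Real.log_mul (by positivity) (by positivity)]
  have h8 : 0 < 2 / eta := by positivity
  have : -(2 / eta * Real.log (1 + lam)) - 2 / eta * Real.log α.card = 2 / eta * (-Real.log C) := by
    rw [h7]; ring
  rw [this]
  gcongr
  linarith

lemma exists_cover (q : ℕ) : ∃ M : ℕ, 2 ≤ M ∧ ∀ (R : ℝ), 0 < R → ∀ k : ℕ,
    ∃ α : Finset (EuclideanSpace ℝ (Fin q)), α.Nonempty ∧ α.card ≤ M ^ k ∧
      ∀ x ∈ closedBall (0 : EuclideanSpace ℝ (Fin q)) R, ∃ a ∈ α, dist x a ≤ R / 2 ^ k := by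
  classical
  obtain ⟨T, -, hTf, hT⟩ := (isCompact_closedBall (0 : EuclideanSpace ℝ (Fin q)) 1).finite_cover_balls
    (e := 1 / 2) (by norm_num)
  lift T to Finset (EuclideanSpace ℝ (Fin q)) using hTf
  refine ⟨T.card + 2, by omega, fun R hR k => ?_⟩
  induction k with
  | zero => exact ⟨{0}, by simp, by simp, fun x hx => ⟨0, by simp, by simpa using hx⟩⟩
  | succ k ih =>
    obtain ⟨α, h1, h2, h3⟩ := ih
    have hTn : T.Nonempty := by
      have := hT (mem_closedBall_self zero_le_one)
      simp only [Set.mem_iUnion] at this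
      obtain ⟨t, ht, -⟩ := this
      exact ⟨t, by simpa using ht⟩
    refine ⟨Finset.image₂ (fun a t => a + (R / 2 ^ k) • t) α T, h1.image₂ hTn, ?_, ?_⟩
    · refine (Finset.card_image₂_le _ _ _).trans ?_
      rw [pow_succ]
      exact Nat.mul_le_mul h2 (by omega)
    · intro x hx
      obtain ⟨a, ha, hxa⟩ := h3 x hx
      have hr : 0 < R / 2 ^ k := by positivity
      have hy : (R / 2 ^ k)⁻¹ • (x - a) ∈ closedBall (0 : EuclideanSpace ℝ (Fin q)) 1 := by
        rw [mem_closedBall_zero_iff, norm_smul, norm_inv, Real.norm_of_nonneg hr.le,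
          inv_mul_le_iff₀ hr, mul_one, ← dist_eq_norm]
        exact hxa
      have := hT hy
      simp only [Set.mem_iUnion] at this
      obtain ⟨t, ht, hd⟩ := this
      refine ⟨a + (R / 2 ^ k) • t, Finset.mem_image₂_of_mem ha (by simpa using ht), ?_⟩
      have e : x - (a + (R / 2 ^ k) • t) = (R / 2 ^ k) • ((R / 2 ^ k)⁻¹ • (x - a) - t) := by
        rw [smul_sub, smul_smul, mul_inv_cancel₀ hr.ne', one_smul]; abel
      rw [dist_eq_norm, e, norm_smul, Real.norm_of_nonneg hr.le, ← dist_eq_norm]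
      rw [mem_ball] at hd
      calc _ ≤ R / 2 ^ k * (1 / 2) := by gcongr
        _ = _ := by rw [pow_succ]; field_simp

lemma similar_surj (f : EuclideanSpace ℝ (Fin q) → EuclideanSpace ℝ (Fin q)) (s : ℝ) (hs : 0 < s)
    (hf : ∀ x y, dist (f x) (f y) = s * dist x y) : Function.Bijective f := by
  have hi : Isometry (fun x => s⁻¹ • f x) := by
    refine Isometry.of_dist_eq fun x y => ?_
    rw [dist_smul₀, hf, norm_inv, Real.norm_of_nonneg hs.le, inv_mul_cancel_left₀ hs.ne']
  have hsurj : Function.Surjective (fun x => s⁻¹ • f x) := by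
    have h := (hi.affineIsometryOfStrictConvexSpace.toAffineIsometryEquiv rfl).surjective
    simpa using h
  refine ⟨fun x y h => hi.injective (by simp [h]), fun y => ?_⟩
  obtain ⟨x, hx⟩ := hsurj (s⁻¹ • y)
  exact ⟨x, smul_right_injective _ (inv_ne_zero hs.ne') hx⟩

lemma infDist_similar (f : EuclideanSpace ℝ (Fin q) → EuclideanSpace ℝ (Fin q)) (s : ℝ) (hs : 0 < s)
    (hf : ∀ x y, dist (f x) (f y) = s * dist x y) (β : Set (EuclideanSpace ℝ (Fin q)))
    (hβ : β.Finite) (hn : β.Nonempty) (x : EuclideanSpace ℝ (Fin q)) :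
    infDist (f x) (f '' β) = s * infDist x β := by
  apply le_antisymm
  · obtain ⟨b, hb, h⟩ := hβ.isCompact.exists_infDist_eq_dist hn x
    rw [h, ← hf]
    exact infDist_le_dist_of_mem (Set.mem_image_of_mem f hb)
  · obtain ⟨_, ⟨b, hb, rfl⟩, h⟩ := (hβ.image f).isCompact.exists_infDist_eq_dist (hn.image f) (f x)
    rw [h, hf]
    gcongr
    exact infDist_le_dist_of_mem hb
end

section
variable {q : ℕ} {P : Measure (EuclideanSpace ℝ (Fin q))} {lam eta : ℝ}

lemma gE_le (α : Finset (EuclideanSpace ℝ (Fin q))) (hα : α.Nonempty) (n : ℕ)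
    (hn : α.card ≤ n) : geomError P n ≤
      Real.exp (∫ x, Real.log (infDist x (↑α : Set (EuclideanSpace ℝ (Fin q)))) ∂P) := by
  refine csInf_le ⟨0, ?_⟩ ⟨α, hα, hn, rfl⟩
  rintro r ⟨β, -, -, rfl⟩
  exact (Real.exp_pos _).le

lemma le_gE (n : ℕ) (hn : 1 ≤ n) (c : ℝ)
    (h : ∀ α : Finset (EuclideanSpace ℝ (Fin q)), α.Nonempty → α.card ≤ n →
      c ≤ ∫ x, Real.log (infDist x (↑α : Set (EuclideanSpace ℝ (Fin q)))) ∂P) :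
    Real.exp c ≤ geomError P n := by
  refine le_csInf ⟨_, {0}, by simp, by simpa using hn, rfl⟩ ?_
  rintro r ⟨β, h1, h2, rfl⟩
  exact Real.exp_le_exp.2 (h β h1 h2)

lemma le_V (n : ℕ) (hn : 1 ≤ n) (c : ℝ)
    (h : ∀ α : Finset (EuclideanSpace ℝ (Fin q)), α.Nonempty → α.card ≤ n →
      c ≤ ∫ x, Real.log (infDist x (↑α : Set (EuclideanSpace ℝ (Fin q)))) ∂P) :
    c ≤ Real.log (geomError P n) := by
  have := Real.log_le_log (Real.exp_pos _) (le_gE n hn c h)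
  rwa [Real.log_exp] at this

lemma exists_near (n : ℕ) (hn : 1 ≤ n) (δ : ℝ) (hδ : 0 < δ) :
    ∃ α : Finset (EuclideanSpace ℝ (Fin q)), α.Nonempty ∧ α.card ≤ n ∧
      ∫ x, Real.log (infDist x (↑α : Set (EuclideanSpace ℝ (Fin q)))) ∂P ≤
        Real.log (geomError P n) + δ := by
  by_contra! h
  have := le_V (P := P) n hn (Real.log (geomError P n) + δ) fun α h1 h2 => (h α h1 h2).le
  linarith

variable [IsProbabilityMeasure P] (hlam : 0 < lam) (heta : 0 < eta)
    (hball : ∀ (x : EuclideanSpace ℝ (Fin q)) (ε : ℝ), 0 < ε →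
      P (closedBall x ε) ≤ ENNReal.ofReal (lam * ε ^ eta))
    (hc : ∃ K : Set (EuclideanSpace ℝ (Fin q)), IsCompact K ∧ P Kᶜ = 0)

include hlam heta hball hc

lemma lower_all (n : ℕ) (α : Finset (EuclideanSpace ℝ (Fin q))) (hα : α.Nonempty)
    (hn : α.card ≤ n) : -(2 / eta * Real.log (1 + lam)) - 2 / eta * Real.log n ≤
      ∫ x, Real.log (infDist x (↑α : Set (EuclideanSpace ℝ (Fin q)))) ∂P := by
  refine le_trans ?_ (log_int_lower hlam heta hball hc α hα)
  have hcard : (0:ℝ) < α.card := by exact_mod_cast hα.card_pos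
  gcongr

lemma geom_pos (n : ℕ) (hn : 1 ≤ n) : 0 < geomError P n :=
  (Real.exp_pos _).trans_le (le_gE n hn _ fun α h1 h2 =>
    lower_all hlam heta hball hc n α h1 h2)

lemma V_lower (n : ℕ) (hn : 1 ≤ n) :
    -(2 / eta * Real.log (1 + lam)) - 2 / eta * Real.log n ≤ Real.log (geomError P n) :=
  le_V n hn _ fun α h1 h2 => lower_all hlam heta hball hc n α h1 h2

lemma V_le (α : Finset (EuclideanSpace ℝ (Fin q))) (hα : α.Nonempty) (n : ℕ)
    (hn : α.card ≤ n) : Real.log (geomError P n) ≤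
      ∫ x, Real.log (infDist x (↑α : Set (EuclideanSpace ℝ (Fin q)))) ∂P := by
  have h1 := Real.log_le_log (geom_pos hlam heta hball hc n (hα.card_pos.trans_le hn))
    (gE_le (P := P) α hα n hn)
  rwa [Real.log_exp] at h1

lemma V_anti (m n : ℕ) (hm : 1 ≤ m) (hmn : m ≤ n) :
    Real.log (geomError P n) ≤ Real.log (geomError P m) :=
  le_V m hm _ fun α h1 h2 => V_le hlam heta hball hc α h1 n (h2.trans hmn)

lemma V_upper : ∃ c C : ℝ, 0 < c ∧ ∀ n : ℕ, 1 ≤ n →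
    Real.log (geomError P n) ≤ C - c * Real.log n := by
  obtain ⟨M, hM, hcov⟩ := exists_cover q
  obtain ⟨K, hK, hPK⟩ := id hc
  obtain ⟨R, hR⟩ := (isBounded_iff_subset_closedBall 0).1 hK.isBounded
  have hR' : (0:ℝ) < max R 1 := by positivity
  have hM' : (1:ℝ) < M := by exact_mod_cast hM
  have hlM : 0 < Real.log M := Real.log_pos hM'
  have hl2 : 0 < Real.log 2 := Real.log_pos (by norm_num)
  refine ⟨Real.log 2 / Real.log M, Real.log (max R 1) + Real.log 2, by positivity, fun n hn => ?_⟩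
  obtain ⟨α, h1, h2, h3⟩ := hcov (max R 1) hR' (Nat.log M n)
  have h4 := V_le hlam heta hball hc α h1 n (h2.trans (Nat.pow_log_le_self M (by omega)))
  have hmem : ∀ᵐ x ∂P, x ∈ K := by
    rw [ae_iff]; exact hPK
  have h5 : ∫ x, Real.log (infDist x (↑α : Set (EuclideanSpace ℝ (Fin q)))) ∂P ≤
      ∫ x, Real.log (max R 1 / 2 ^ (Nat.log M n)) ∂P := by
    refine integral_mono_ae (log_integrable hlam heta hball hc α h1) (integrable_const _) ?_
    filter_upwards [hmem, ae_pos heta hball α h1] with x hx hpos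
    obtain ⟨a, ha, hxa⟩ := h3 x (closedBall_subset_closedBall (le_max_left _ _) (hR hx))
    exact Real.log_le_log hpos ((infDist_le_dist_of_mem (by simpa using ha)).trans hxa)
  rw [integral_const, probReal_univ, one_smul,
    Real.log_div hR'.ne' (by positivity), Real.log_pow] at h5
  have h6 : Real.log n ≤ (Nat.log M n + 1) * Real.log M := by
    have h7 : (n:ℝ) ≤ (M:ℝ) ^ (Nat.log M n + 1) := by
      exact_mod_cast (Nat.lt_pow_succ_log_self (by omega) n).le
    have h8 := Real.log_le_log (by exact_mod_cast hn) h7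
    rw [Real.log_pow] at h8
    exact_mod_cast h8
  have h9 : Real.log 2 / Real.log M * Real.log n ≤ Real.log 2 * (Nat.log M n + 1) := by
    rw [div_mul_eq_mul_div, div_le_iff₀ hlM, mul_assoc]
    gcongr
  linarith

lemma log_similar (f : EuclideanSpace ℝ (Fin q) → EuclideanSpace ℝ (Fin q)) (s : ℝ) (hs : 0 < s)
    (hf : ∀ x y, dist (f x) (f y) = s * dist x y)
    (α : Finset (EuclideanSpace ℝ (Fin q))) (hα : α.Nonempty) :
    ∃ β : Finset (EuclideanSpace ℝ (Fin q)), β.Nonempty ∧ β.card = α.card ∧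
      (β : Set (EuclideanSpace ℝ (Fin q))) = f ⁻¹' α ∧
      (∀ x, infDist (f x) (α : Set (EuclideanSpace ℝ (Fin q))) =
        s * infDist x (β : Set (EuclideanSpace ℝ (Fin q)))) ∧
      Integrable (fun x => Real.log (infDist (f x) (α : Set (EuclideanSpace ℝ (Fin q))))) P ∧
      ∫ x, Real.log (infDist (f x) (α : Set (EuclideanSpace ℝ (Fin q)))) ∂P =
        Real.log s + ∫ x, Real.log (infDist x (β : Set (EuclideanSpace ℝ (Fin q)))) ∂P := by
  classical
  have hb := similar_surj f s hs hf
  have himg : (α.preimage f hb.1.injOn).image f = α :=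
    Finset.image_preimage_of_bijective α hb
  set β := α.preimage f hb.1.injOn
  have hβ : β.Nonempty := by
    rw [← Finset.image_nonempty (f := f), himg]; exact hα
  have hd : ∀ x, infDist (f x) (α : Set (EuclideanSpace ℝ (Fin q))) =
        s * infDist x (β : Set (EuclideanSpace ℝ (Fin q))) := by
    intro x
    rw [← infDist_similar f s hs hf β β.finite_toSet (by simpa using hβ) x, ← himg]
    simp
  have hae : (fun x => Real.log (infDist (f x) (α : Set (EuclideanSpace ℝ (Fin q))))) =ᵐ[P]
      fun x => Real.log s + Real.log (infDist x (β : Set (EuclideanSpace ℝ (Fin q)))) := by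
    filter_upwards [ae_pos heta hball β hβ] with x hx
    rw [hd, Real.log_mul hs.ne' hx.ne']
  have hI := log_integrable hlam heta hball hc β hβ
  refine ⟨β, hβ, ?_, Finset.coe_preimage _ _, hd, ?_, ?_⟩
  · rw [← himg, Finset.card_image_of_injective _ hb.1]
  · exact ((integrable_const _).add hI).congr hae.symm
  · rw [integral_congr_ae hae, integral_add (integrable_const _) hI]
    simp
end

theorem stmt4 (q N : ℕ) (hq : 1 ≤ q) (hN : 1 ≤ N)
    (f : Fin N → EuclideanSpace ℝ (Fin q) → EuclideanSpace ℝ (Fin q))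
    (s : Fin N → ℝ) (hs : ∀ i, s i ∈ Set.Ioo (0 : ℝ) 1)
    (hf : ∀ i x y, dist (f i x) (f i y) = s i * dist x y)
    (p : Fin (N + 1) → ℝ) (hp : ∀ i, 0 < p i) (hpsum : ∑ i, p i = 1)
    (ν : Measure (EuclideanSpace ℝ (Fin q))) (hνp : IsProbabilityMeasure ν)
    (hνc : ∃ K : Set (EuclideanSpace ℝ (Fin q)), IsCompact K ∧ ν Kᶜ = 0)
    (μ : Measure (EuclideanSpace ℝ (Fin q))) (hμp : IsProbabilityMeasure μ)
    (hμc : ∃ K : Set (EuclideanSpace ℝ (Fin q)), IsCompact K ∧ μ Kᶜ = 0)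
    (hμ : μ = ENNReal.ofReal (p 0) • ν + ∑ i : Fin N, ENNReal.ofReal (p i.succ) • μ.map (f i))
    (lam eta : ℝ) (hlam : 0 < lam) (heta : 0 < eta)
    (hball : ∀ (x : EuclideanSpace ℝ (Fin q)) (ε : ℝ), 0 < ε →
      ν (closedBall x ε) ≤ ENNReal.ofReal (lam * ε ^ eta) ∧
      μ (closedBall x ε) ≤ ENNReal.ofReal (lam * ε ^ eta)) :
    liminf (fun n : ℕ => Real.log n / (-Real.log (geomError ν n))) atTop ≤
      liminf (fun n : ℕ => Real.log n / (-Real.log (geomError μ n))) atTop ∧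
    liminf (fun n : ℕ => Real.log n / (-Real.log (geomError μ n))) atTop ≤
      limsup (fun n : ℕ => Real.log n / (-Real.log (geomError μ n))) atTop ∧
    limsup (fun n : ℕ => Real.log n / (-Real.log (geomError μ n))) atTop ≤
      limsup (fun n : ℕ => Real.log n / (-Real.log (geomError ν n))) atTop ∧
    ∀ d₀ : ℝ,
      Tendsto (fun n : ℕ => Real.log n / (-Real.log (geomError ν n))) atTop (nhds d₀) →
      (Tendsto (fun n : ℕ => Real.log n / (-Real.log (geomError μ n))) atTop (nhds d₀) ∧
        (0 < liminf (fun n : ℕ => ENNReal.ofReal ((n : ℝ) ^ (1 / d₀) * geomError ν n)) atTop →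
          0 < liminf (fun n : ℕ => ENNReal.ofReal ((n : ℝ) ^ (1 / d₀) * geomError μ n)) atTop)) := by
  
  classical
  have hbν := fun x ε hε => (hball x ε hε).1
  have hbμ := fun x ε hε => (hball x ε hε).2
  have hs0 : ∀ i, 0 < s i := fun i => (hs i).1
  have hfm : ∀ i, Measurable (f i) := fun i => by
    have : LipschitzWith (Real.toNNReal (s i)) (f i) := by
      refine LipschitzWith.of_dist_le_mul fun x y => ?_
      rw [Real.coe_toNNReal _ (hs0 i).le, hf]
    exact this.continuous.measurable
  have hps : ∑ i : Fin N, p i.succ = 1 - p 0 := by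
    rw [Fin.sum_univ_succ] at hpsum; linarith
  have hp01 : p 0 < 1 := by
    have : 0 < ∑ i : Fin N, p i.succ :=
      Finset.sum_pos (fun i _ => hp _) ⟨⟨0, hN⟩, Finset.mem_univ _⟩
    linarith
  have decomp : ∀ α : Finset (EuclideanSpace ℝ (Fin q)), α.Nonempty →
      ∫ x, Real.log (infDist x (α : Set (EuclideanSpace ℝ (Fin q)))) ∂μ =
        p 0 * ∫ x, Real.log (infDist x (α : Set (EuclideanSpace ℝ (Fin q)))) ∂ν +
        ∑ i : Fin N, p i.succ *
          ∫ x, Real.log (infDist (f i x) (α : Set (EuclideanSpace ℝ (Fin q)))) ∂μ := by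
    intro α hα
    have hm : Measurable
        (fun x => Real.log (infDist x (α : Set (EuclideanSpace ℝ (Fin q))))) :=
      Real.measurable_log.comp measurable_infDist
    have hi : ∀ i : Fin N, Integrable
        (fun x => Real.log (infDist x (α : Set (EuclideanSpace ℝ (Fin q))))) (μ.map (f i)) := by
      intro i
      rw [integrable_map_measure hm.aestronglyMeasurable (hfm i).aemeasurable]
      obtain ⟨β, -, -, -, -, h, -⟩ :=
        log_similar hlam heta hbμ hμc (f i) (s i) (hs0 i) (hf i) α hα
      exact h
    have h1 := congrArg (fun m : Measure (EuclideanSpace ℝ (Fin q)) =>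
      ∫ x, Real.log (infDist x (α : Set (EuclideanSpace ℝ (Fin q)))) ∂m) hμ
    rw [h1, integral_add_measure, integral_smul_measure, integral_finsetSum_measure]
    · rw [ENNReal.toReal_ofReal (hp 0).le, smul_eq_mul]
      congr 1
      refine Finset.sum_congr rfl fun i _ => ?_
      rw [integral_smul_measure, ENNReal.toReal_ofReal (hp _).le, smul_eq_mul,
        integral_map (hfm i).aemeasurable hm.aestronglyMeasurable]
    · exact fun i _ => (hi i).smul_measure ENNReal.ofReal_ne_top
    · exact (log_integrable hlam heta hbν hνc α hα).smul_measure ENNReal.ofReal_ne_top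
    · exact integrable_finsetSum_measure.2
        fun i _ => (hi i).smul_measure ENNReal.ofReal_ne_top
  set u : ℕ → ℝ := fun n => Real.log (geomError ν n) with hu
  set v : ℕ → ℝ := fun n => Real.log (geomError μ n) with hv
  set S : ℝ := ∑ i : Fin N, p i.succ * Real.log (s i) with hS
  have hS0 : S ≤ 0 := Finset.sum_nonpos fun i _ =>
    mul_nonpos_of_nonneg_of_nonpos (hp _).le (Real.log_nonpos (hs0 i).le (hs i).2.le)
  have H1 : ∀ n, 1 ≤ n → -v n ≤ -u n + (-S / p 0) := by
    intro n hn
    have h1 : p 0 * u n + S + (1 - p 0) * v n ≤ v n := by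
      refine le_V n hn _ fun α hα hc => ?_
      rw [decomp α hα, ← hps, Finset.sum_mul, add_assoc, ← Finset.sum_add_distrib]
      refine add_le_add (mul_le_mul_of_nonneg_left (V_le hlam heta hbν hνc α hα n hc) (hp 0).le)
        (Finset.sum_le_sum fun i _ => ?_)
      obtain ⟨β, hβ, hβc, -, -, -, h⟩ :=
        log_similar hlam heta hbμ hμc (f i) (s i) (hs0 i) (hf i) α hα
      rw [h, ← mul_add]
      have := V_le hlam heta hbμ hμc β hβ n (hβc.trans_le hc)
      exact mul_le_mul_of_nonneg_left (by linarith) (hp _).le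
    have h2 : p 0 * (u n - v n) ≤ -S := by linarith
    have h3 : u n - v n ≤ -S / p 0 := by
      rw [le_div_iff₀ (hp 0)]; linarith
    linarith
  have H2 : ∀ m, 1 ≤ m → v ((N + 1) * m) ≤ p 0 * u m + (1 - p 0) * v m := by
    intro m hm
    refine le_of_forall_pos_le_add fun δ hδ => ?_
    obtain ⟨α, hα, hαc, hαI⟩ := exists_near (P := ν) m hm δ hδ
    obtain ⟨β, hβ, hβc, hβI⟩ := exists_near (P := μ) m hm δ hδ
    set γ : Finset (EuclideanSpace ℝ (Fin q)) :=
      α ∪ Finset.univ.biUnion (fun i : Fin N => β.image (f i)) with hγ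
    have hγn : γ.Nonempty := hα.mono Finset.subset_union_left
    have hγc : γ.card ≤ (N + 1) * m := by
      refine (Finset.card_union_le _ _).trans ?_
      have : (Finset.univ.biUnion (fun i : Fin N => β.image (f i))).card ≤
          (Finset.univ : Finset (Fin N)).card * m :=
        Finset.card_biUnion_le_card_mul _ _ _ fun i _ => Finset.card_image_le.trans hβc
      rw [Finset.card_univ, Fintype.card_fin] at this
      linarith
    refine (V_le hlam heta hbμ hμc γ hγn _ hγc).trans ?_
    rw [decomp γ hγn]
    have h1 : ∫ x, Real.log (infDist x (γ : Set (EuclideanSpace ℝ (Fin q)))) ∂ν ≤ u m + δ := by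
      refine le_trans (integral_mono_ae (log_integrable hlam heta hbν hνc γ hγn)
        (log_integrable hlam heta hbν hνc α hα) ?_) hαI
      filter_upwards [ae_pos heta hbν γ hγn] with x hx
      refine Real.log_le_log hx (infDist_le_infDist_of_subset ?_ (by simpa using hα))
      exact_mod_cast Finset.subset_union_left
    have h2 : ∀ i : Fin N,
        ∫ x, Real.log (infDist (f i x) (γ : Set (EuclideanSpace ℝ (Fin q)))) ∂μ ≤ v m + δ := by
      intro i
      have hβI' := log_integrable hlam heta hbμ hμc β hβ
      obtain ⟨γ', hγ', -, -, hd, hI, -⟩ :=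
        log_similar hlam heta hbμ hμc (f i) (s i) (hs0 i) (hf i) γ hγn
      refine le_trans (integral_mono_ae hI hβI' ?_) hβI
      filter_upwards [ae_pos heta hbμ γ' hγ'] with x hx
      refine Real.log_le_log ?_ ?_
      · rw [hd]; exact mul_pos (hs0 i) hx
      · have hsub : f i '' (β : Set (EuclideanSpace ℝ (Fin q))) ⊆ γ := by
          rw [← Finset.coe_image]
          exact_mod_cast (Finset.subset_biUnion_of_mem (fun i : Fin N => β.image (f i))
            (Finset.mem_univ i)).trans Finset.subset_union_right
        have hβn : (β : Set (EuclideanSpace ℝ (Fin q))).Nonempty := by simpa using hβ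
        refine (infDist_le_infDist_of_subset hsub (hβn.image _)).trans ?_
        rw [infDist_similar (f i) (s i) (hs0 i) (hf i) β β.finite_toSet hβn]
        exact mul_le_of_le_one_left infDist_nonneg (hs i).2.le
    have h3 : ∑ i : Fin N, p i.succ *
        ∫ x, Real.log (infDist (f i x) (γ : Set (EuclideanSpace ℝ (Fin q)))) ∂μ ≤
        (1 - p 0) * (v m + δ) := by
      rw [← hps, Finset.sum_mul]
      exact Finset.sum_le_sum fun i _ => mul_le_mul_of_nonneg_left (h2 i) (hp _).le
    have h4 := mul_le_mul_of_nonneg_left h1 (hp 0).le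
    linarith
  obtain ⟨c1, C1, hc1, hU1⟩ := V_upper hlam heta hbν hνc
  obtain ⟨c2, C2, hc2, hU2⟩ := V_upper hlam heta hbμ hμc
  obtain ⟨tu, bu1, bu2, -⟩ := seq_bounds u c1 C1 _ _ hc1 hU1 (V_lower hlam heta hbν hνc)
  obtain ⟨tv, bv1, bv2, bv3⟩ := seq_bounds v c2 C2 _ _ hc2 hU2 (V_lower hlam heta hbμ hμc)
  have P1 := seq_part1 u v _ H1 tu tv bu2 bv1
  have P3 := seq_part3 u v (N + 1) (by omega) (p 0) (hp 0) hp01 H2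
    (V_anti hlam heta hbμ hμc) tu tv bu1 bv2 bv3
  refine ⟨P1, liminf_le_limsup bv1 bv2, P3, fun d₀ hd => ⟨?_, fun hQ => ?_⟩⟩
  · refine tendsto_of_le_liminf_of_limsup_le ?_ ?_ bv1 bv2
    · rw [← hd.liminf_eq]; exact P1
    · rw [← hd.limsup_eq]; exact P3
  · obtain ⟨ε, hε0, hε⟩ := exists_between hQ
    set κ : ℝ := Real.exp (S / p 0) with hκ
    have hpos : 0 < ENNReal.ofReal κ * ε :=
      ENNReal.mul_pos (by simpa using Real.exp_pos _) hε0.ne'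
    refine lt_of_lt_of_le hpos (le_liminf_of_le (by isBoundedDefault) ?_)
    filter_upwards [eventually_lt_of_lt_liminf hε, eventually_ge_atTop 1] with n h1 h2
    have g1 := geom_pos hlam heta hbν hνc n h2
    have g2 := geom_pos hlam heta hbμ hμc n h2
    have g3 : κ * geomError ν n ≤ geomError μ n := by
      have h3 := H1 n h2
      rw [neg_div] at h3
      rw [← Real.exp_log g1, ← Real.exp_log g2, hκ, ← Real.exp_add]
      refine Real.exp_le_exp.2 ?_
      simp only [hu, hv] at h3
      linarith
    refine (mul_le_mul_right h1.le _).trans ?_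
    rw [← ENNReal.ofReal_mul (Real.exp_pos _).le]
    refine ENNReal.ofReal_le_ofReal ?_
    have h4 : (0:ℝ) ≤ (n:ℝ) ^ (1 / d₀) := by positivity
    calc κ * ((n:ℝ) ^ (1 / d₀) * geomError ν n) = (n:ℝ) ^ (1 / d₀) * (κ * geomError ν n) := by ring
      _ ≤ _ := mul_le_mul_of_nonneg_left g3 h4
end

section
/- For every n ≥ N + 1 one has ê_n(μ) ≤ p₀ ê_{⌊n/(N+1)⌋}(ν) + (1 − p₀) ê_{⌊n/(N+1)⌋}(μ) + Σ_{i=1}^N p_i log s_i. -/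
open MeasureTheory Filter Metric

/-- `ê_n(P)`, the logarithmic version of the `n`-th geometric mean error. -/
noncomputable def hatE {q : ℕ} (P : Measure (EuclideanSpace ℝ (Fin q))) (n : ℕ) : ℝ :=
  sInf {r : ℝ | ∃ α : Finset (EuclideanSpace ℝ (Fin q)), α.Nonempty ∧ α.card ≤ n ∧
    r = ∫ x, Real.log (infDist x (↑α : Set (EuclideanSpace ℝ (Fin q)))) ∂P}

lemma aux_neg {q : ℕ} (P : Measure (EuclideanSpace ℝ (Fin q))) [IsProbabilityMeasure P]
    (lam eta : ℝ) (hlam : 0 < lam) (heta : 0 < eta)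
    (hball : ∀ (x : EuclideanSpace ℝ (Fin q)) (ε : ℝ), 0 < ε →
      P (closedBall x ε) ≤ ENNReal.ofReal (lam * ε ^ eta)) :
    ∃ C : ℝ, 0 ≤ C ∧ ∀ a : EuclideanSpace ℝ (Fin q),
      Integrable (fun x => max 0 (-Real.log (dist x a))) P ∧
      ∫ x, max 0 (-Real.log (dist x a)) ∂P ≤ C := by
  have hint : IntegrableOn (fun t : ℝ => lam * Real.exp (-eta * t)) (Set.Ioi 0) :=
    (integrableOn_exp_mul_Ioi (by linarith) 0).const_mul lam
  have hfin : ∫⁻ t in Set.Ioi (0:ℝ), ENNReal.ofReal (lam * Real.exp (-eta * t)) < ⊤ :=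
    hint.lintegral_lt_top
  refine ⟨(∫⁻ t in Set.Ioi (0:ℝ), ENNReal.ofReal (lam * Real.exp (-eta * t))).toReal,
    ENNReal.toReal_nonneg, fun a => ?_⟩
  have hm : Measurable (fun x : EuclideanSpace ℝ (Fin q) => max 0 (-Real.log (dist x a))) := by
    fun_prop
  have hnn : ∀ x : EuclideanSpace ℝ (Fin q), 0 ≤ max 0 (-Real.log (dist x a)) :=
    fun x => le_max_left _ _
  have hle : ∫⁻ x, ENNReal.ofReal (max 0 (-Real.log (dist x a))) ∂P ≤
      ∫⁻ t in Set.Ioi (0:ℝ), ENNReal.ofReal (lam * Real.exp (-eta * t)) := by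
    rw [lintegral_eq_lintegral_meas_le P (Eventually.of_forall hnn) hm.aemeasurable]
    refine setLIntegral_mono' measurableSet_Ioi fun t ht => ?_
    have ht : 0 < t := ht
    have h1 := hball a (Real.exp (-t)) (Real.exp_pos _)
    rw [← Real.exp_mul] at h1
    refine le_trans (measure_mono ?_) (h1.trans_eq (by ring_nf))
    intro x hx
    simp only [Set.mem_ofPred_eq, le_max_iff] at hx
    rcases hx with hx | hx
    · linarith
    · rw [mem_closedBall]
      rcases (dist_nonneg (x := x) (y := a)).eq_or_lt with h | h
      · rw [← h]; positivity
      · rw [← Real.log_le_iff_le_exp h]; linarith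
  constructor
  · refine ⟨hm.aestronglyMeasurable, ?_⟩
    rw [hasFiniteIntegral_iff_ofReal (Eventually.of_forall hnn)]
    exact hle.trans_lt hfin
  · rw [integral_eq_lintegral_of_nonneg_ae (Eventually.of_forall hnn) hm.aestronglyMeasurable]
    exact ENNReal.toReal_mono hfin.ne hle

lemma aux_exists {q : ℕ} (α : Finset (EuclideanSpace ℝ (Fin q))) (hα : α.Nonempty)
    (x : EuclideanSpace ℝ (Fin q)) :
    ∃ a ∈ α, infDist x (↑α : Set (EuclideanSpace ℝ (Fin q))) = dist x a := by
  obtain ⟨a, ha, h⟩ := α.finite_toSet.isCompact.exists_infDist_eq_dist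
    (by simpa using hα) x
  exact ⟨a, by simpa using ha, h⟩

lemma aux_int {q : ℕ} (P : Measure (EuclideanSpace ℝ (Fin q))) [IsProbabilityMeasure P]
    (hc : ∃ K : Set (EuclideanSpace ℝ (Fin q)), IsCompact K ∧ P Kᶜ = 0)
    (lam eta : ℝ) (hlam : 0 < lam) (heta : 0 < eta)
    (hball : ∀ (x : EuclideanSpace ℝ (Fin q)) (ε : ℝ), 0 < ε →
      P (closedBall x ε) ≤ ENNReal.ofReal (lam * ε ^ eta)) :
    ∃ C : ℝ, 0 ≤ C ∧ ∀ α : Finset (EuclideanSpace ℝ (Fin q)), α.Nonempty →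
      Integrable (fun x => Real.log (infDist x (↑α : Set (EuclideanSpace ℝ (Fin q))))) P ∧
      -(α.card * C) ≤ ∫ x, Real.log (infDist x (↑α : Set (EuclideanSpace ℝ (Fin q)))) ∂P := by
  obtain ⟨C, hC, h⟩ := aux_neg P lam eta hlam heta hball
  obtain ⟨K, hK, hPK⟩ := hc
  refine ⟨C, hC, fun α hα => ?_⟩
  obtain ⟨a, ha⟩ := hα
  obtain ⟨M, hM⟩ := hK.isBounded.subset_closedBall a
  have hG : Integrable (fun x => ∑ b ∈ α, max 0 (-Real.log (dist x b))) P :=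
    integrable_finsetSum _ fun b _ => (h b).1
  have hlow : ∀ x, -(∑ b ∈ α, max 0 (-Real.log (dist x b))) ≤
      Real.log (infDist x (↑α : Set (EuclideanSpace ℝ (Fin q)))) := by
    intro x
    obtain ⟨b, hb, e⟩ := aux_exists α ⟨a, ha⟩ x
    rw [e]
    have := Finset.single_le_sum (f := fun b => max 0 (-Real.log (dist x b)))
      (fun i _ => le_max_left _ _) hb
    have h2 := le_max_right 0 (-Real.log (dist x b))
    linarith
  have hup : ∀ᵐ x ∂P, Real.log (infDist x (↑α : Set (EuclideanSpace ℝ (Fin q)))) ≤ M := by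
    have : ∀ᵐ x ∂P, x ∈ K := hPK
    filter_upwards [this] with x hx
    exact (Real.log_le_self infDist_nonneg).trans
      ((infDist_le_dist_of_mem (by simpa using ha)).trans (hM hx))
  have hI : Integrable (fun x => Real.log (infDist x (↑α : Set (EuclideanSpace ℝ (Fin q))))) P := by
    refine Integrable.mono' (hG.add (integrable_const |M|)) ?_ ?_
    · exact (Real.measurable_log.comp (continuous_infDist_pt _).measurable).aestronglyMeasurable
    · filter_upwards [hup] with x hx
      have h1 := hlow x
      have h2 : 0 ≤ ∑ b ∈ α, max 0 (-Real.log (dist x b)) :=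
        Finset.sum_nonneg fun i _ => le_max_left _ _
      have h3 := le_abs_self M
      have h4 := abs_nonneg M
      rw [Real.norm_eq_abs, abs_le]
      simp only [Pi.add_apply]
      constructor <;> linarith
  refine ⟨hI, ?_⟩
  have h5 := integral_mono hG.neg hI hlow
  refine le_trans ?_ h5
  simp only [Pi.neg_apply]
  rw [integral_neg, integral_finsetSum _ fun b _ => (h b).1, neg_le_neg_iff]
  refine (Finset.sum_le_sum fun b _ => (h b).2).trans_eq ?_
  simp

lemma aux_atom {q : ℕ} (P : Measure (EuclideanSpace ℝ (Fin q)))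
    (lam eta : ℝ) (heta : 0 < eta)
    (hball : ∀ (x : EuclideanSpace ℝ (Fin q)) (ε : ℝ), 0 < ε →
      P (closedBall x ε) ≤ ENNReal.ofReal (lam * ε ^ eta)) : NullSingletonClass P := by
  refine ⟨fun a => ?_⟩
  have hc : Tendsto (fun ε : ℝ => ENNReal.ofReal (lam * ε ^ eta)) (nhdsWithin 0 (Set.Ioi 0))
      (nhds 0) := by
    have : ContinuousAt (fun ε : ℝ => ENNReal.ofReal (lam * ε ^ eta)) 0 :=
      ENNReal.continuous_ofReal.continuousAt.comp
        (continuousAt_const.mul (Real.continuousAt_rpow_const _ _ (Or.inr heta.le)))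
    have h := this.tendsto
    simp only [Real.zero_rpow heta.ne', mul_zero, ENNReal.ofReal_zero] at h
    exact h.mono_left nhdsWithin_le_nhds
  refine le_antisymm (ge_of_tendsto hc ?_) zero_le
  filter_upwards [self_mem_nhdsWithin] with ε hε
  have hε : 0 < ε := hε
  refine (measure_mono ?_).trans (hball a ε hε)
  simpa using hε.le

lemma aux_log {q : ℕ} (γ : Finset (EuclideanSpace ℝ (Fin q))) (hγ : γ.Nonempty)
    (x : EuclideanSpace ℝ (Fin q)) (hx : x ∉ γ) :
    0 < infDist x (↑γ : Set (EuclideanSpace ℝ (Fin q))) := by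
  obtain ⟨b, hb, e⟩ := aux_exists γ hγ x
  rw [e, dist_pos]
  rintro rfl
  exact hx hb

theorem stmt6 (q N : ℕ) (hq : 1 ≤ q) (hN : 1 ≤ N)
    (f : Fin N → EuclideanSpace ℝ (Fin q) → EuclideanSpace ℝ (Fin q))
    (s : Fin N → ℝ) (hs : ∀ i, s i ∈ Set.Ioo (0 : ℝ) 1)
    (hf : ∀ i x y, dist (f i x) (f i y) = s i * dist x y)
    (p : Fin (N + 1) → ℝ) (hp : ∀ i, 0 < p i) (hpsum : ∑ i, p i = 1)
    (ν : Measure (EuclideanSpace ℝ (Fin q))) (hνp : IsProbabilityMeasure ν)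
    (hνc : ∃ K : Set (EuclideanSpace ℝ (Fin q)), IsCompact K ∧ ν Kᶜ = 0)
    (μ : Measure (EuclideanSpace ℝ (Fin q))) (hμp : IsProbabilityMeasure μ)
    (hμc : ∃ K : Set (EuclideanSpace ℝ (Fin q)), IsCompact K ∧ μ Kᶜ = 0)
    (hμ : μ = ENNReal.ofReal (p 0) • ν + ∑ i : Fin N, ENNReal.ofReal (p i.succ) • μ.map (f i))
    (lam eta : ℝ) (hlam : 0 < lam) (heta : 0 < eta)
    (hball : ∀ (x : EuclideanSpace ℝ (Fin q)) (ε : ℝ), 0 < ε →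
      ν (closedBall x ε) ≤ ENNReal.ofReal (lam * ε ^ eta) ∧
      μ (closedBall x ε) ≤ ENNReal.ofReal (lam * ε ^ eta)) :
    ∀ n : ℕ, N + 1 ≤ n →
      hatE μ n ≤ p 0 * hatE ν (n / (N + 1)) + (1 - p 0) * hatE μ (n / (N + 1)) +
        ∑ i : Fin N, p i.succ * Real.log (s i) := by
  classical
  intro n hn
  obtain ⟨Cν, -, hIν⟩ := aux_int ν hνc lam eta hlam heta fun x ε h => (hball x ε h).1
  obtain ⟨Cμ, hCμ, hIμ⟩ := aux_int μ hμc lam eta hlam heta fun x ε h => (hball x ε h).2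
  have hνa : NullSingletonClass ν := aux_atom ν lam eta heta fun x ε h => (hball x ε h).1
  have hμa : NullSingletonClass μ := aux_atom μ lam eta heta fun x ε h => (hball x ε h).2
  set k := n / (N + 1) with hk
  have hk1 : 1 ≤ k := (Nat.one_le_div_iff (by omega)).2 hn
  have hkn : (N + 1) * k ≤ n := Nat.mul_div_le _ _
  have hsum : ∑ i : Fin N, p i.succ = 1 - p 0 := by
    rw [Fin.sum_univ_succ] at hpsum; linarith
  have hp0 : 0 ≤ 1 - p 0 := by
    rw [← hsum]; exact Finset.sum_nonneg fun i _ => (hp _).le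
  have hfc : ∀ i, Continuous (f i) := fun i =>
    (LipschitzWith.of_dist_le_mul (K := (s i).toNNReal) fun x y => by
      rw [hf, Real.coe_toNNReal _ (hs i).1.le]).continuous
  have hfinj : ∀ i, Function.Injective (f i) := fun i x y hxy => by
    have h := hf i x y
    rw [hxy, dist_self] at h
    rcases mul_eq_zero.1 h.symm with h | h
    · exact absurd h (hs i).1.ne'
    · exact dist_eq_zero.1 h
  have key : ∀ α β : Finset (EuclideanSpace ℝ (Fin q)), α.Nonempty → α.card ≤ k →
      β.Nonempty → β.card ≤ k →
      hatE μ n ≤ p 0 * (∫ x, Real.log (infDist x (↑α : Set (EuclideanSpace ℝ (Fin q)))) ∂ν) +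
        (1 - p 0) * (∫ x, Real.log (infDist x (↑β : Set (EuclideanSpace ℝ (Fin q)))) ∂μ) +
        ∑ i : Fin N, p i.succ * Real.log (s i) := by
    intro α β hα hαk hβ hβk
    set γ : Finset (EuclideanSpace ℝ (Fin q)) :=
      α ∪ Finset.univ.biUnion fun i : Fin N => β.image (f i) with hγd
    have hγ : γ.Nonempty := hα.mono Finset.subset_union_left
    have hγc : γ.card ≤ n := by
      refine le_trans ?_ hkn
      refine (Finset.card_union_le _ _).trans ?_
      have h1 : (Finset.univ.biUnion fun i : Fin N => β.image (f i)).card ≤ N * k := by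
        refine Finset.card_biUnion_le.trans ?_
        refine (Finset.sum_le_card_nsmul _ _ k fun i _ => Finset.card_image_le.trans hβk).trans ?_
        simp
      rw [add_mul]; omega
    have h1 : hatE μ n ≤ ∫ x, Real.log (infDist x (↑γ : Set (EuclideanSpace ℝ (Fin q)))) ∂μ := by
      refine csInf_le ⟨-(n * Cμ), ?_⟩ ⟨γ, hγ, hγc, rfl⟩
      rintro r ⟨δ, hδ, hδc, rfl⟩
      refine le_trans ?_ (hIμ δ hδ).2
      have : (δ.card : ℝ) ≤ n := by exact_mod_cast hδc
      exact neg_le_neg (mul_le_mul_of_nonneg_right this hCμ)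
    refine h1.trans ?_
    set g : EuclideanSpace ℝ (Fin q) → ℝ :=
      fun x => Real.log (infDist x (↑γ : Set (EuclideanSpace ℝ (Fin q)))) with hg
    have hgm : Measurable g :=
      Real.measurable_log.comp (continuous_infDist_pt _).measurable
    have hgμ : Integrable g μ := (hIμ γ hγ).1
    have hgμ' := hgμ
    rw [hμ] at hgμ'
    have hgm1 : ∀ i, Integrable g (ENNReal.ofReal (p i.succ) • μ.map (f i)) := by
      intro i
      have := hgμ'.right_of_add_measure
      exact this.mono_measure (Finset.single_le_sum
        (f := fun i : Fin N => ENNReal.ofReal (p i.succ) • μ.map (f i))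
        (fun _ _ => Measure.zero_le _) (Finset.mem_univ i))
    have hgm2 : ∀ i, Integrable (fun x => g (f i x)) μ := by
      intro i
      have := (integrable_smul_measure (by simpa using hp i.succ) (by simp)).1 (hgm1 i)
      exact (integrable_map_measure hgm.aestronglyMeasurable (hfc i).measurable.aemeasurable).1 this
    have hdec : ∫ x, g x ∂μ = p 0 * ∫ x, g x ∂ν + ∑ i : Fin N, p i.succ * ∫ x, g (f i x) ∂μ := by
      conv_lhs => rw [hμ]
      rw [integral_add_measure hgμ'.left_of_add_measure hgμ'.right_of_add_measure,
        integral_finsetSum_measure (fun i _ => hgm1 i), integral_smul_measure,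
        ENNReal.toReal_ofReal (hp 0).le, smul_eq_mul]
      congr 1
      refine Finset.sum_congr rfl fun i _ => ?_
      rw [integral_smul_measure, ENNReal.toReal_ofReal (hp _).le, smul_eq_mul,
        integral_map (hfc i).measurable.aemeasurable hgm.aestronglyMeasurable]
    have hA : ∫ x, g x ∂ν ≤ ∫ x, Real.log (infDist x (↑α : Set (EuclideanSpace ℝ (Fin q)))) ∂ν := by
      refine integral_mono_ae (hIν γ hγ).1 (hIν α hα).1 ?_
      have : ∀ᵐ x ∂ν, x ∉ (γ : Set (EuclideanSpace ℝ (Fin q))) :=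
        measure_eq_zero_iff_ae_notMem.1 (γ.finite_toSet.measure_zero ν)
      filter_upwards [this] with x hx
      refine Real.log_le_log (aux_log γ hγ x (by simpa using hx)) ?_
      exact infDist_le_infDist_of_subset (by
        exact_mod_cast (Finset.subset_union_left : α ⊆ γ)) (by simpa using hα)
    have hB : ∀ i, ∫ x, g (f i x) ∂μ ≤ Real.log (s i) +
        ∫ x, Real.log (infDist x (↑β : Set (EuclideanSpace ℝ (Fin q)))) ∂μ := by
      intro i
      have e : Real.log (s i) + ∫ x, Real.log (infDist x (↑β : Set (EuclideanSpace ℝ (Fin q)))) ∂μ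
          = ∫ x, (Real.log (s i) +
            Real.log (infDist x (↑β : Set (EuclideanSpace ℝ (Fin q))))) ∂μ := by
        rw [integral_add (integrable_const _) (hIμ β hβ).1]; simp
      rw [e]
      refine integral_mono_ae (hgm2 i) ((integrable_const _).add (hIμ β hβ).1) ?_
      have h2 : ∀ᵐ x ∂μ, x ∉ f i ⁻¹' (γ : Set (EuclideanSpace ℝ (Fin q))) :=
        measure_eq_zero_iff_ae_notMem.1
          ((γ.finite_toSet.preimage (hfinj i).injOn).measure_zero μ)
      have h3 : ∀ᵐ x ∂μ, x ∉ (β : Set (EuclideanSpace ℝ (Fin q))) :=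
        measure_eq_zero_iff_ae_notMem.1 (β.finite_toSet.measure_zero μ)
      filter_upwards [h2, h3] with x hx hx3
      have hpos := aux_log β hβ x (by simpa using hx3)
      rw [← Real.log_mul (hs i).1.ne' hpos.ne']
      refine Real.log_le_log (aux_log γ hγ _ (by simpa using hx)) ?_
      obtain ⟨b, hb, e⟩ := aux_exists β hβ x
      rw [e, ← hf]
      refine infDist_le_dist_of_mem ?_
      rw [Finset.mem_coe, hγd]
      refine Finset.mem_union_right _ (Finset.mem_biUnion.2 ⟨i, Finset.mem_univ _, ?_⟩)
      exact Finset.mem_image_of_mem _ hb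
    rw [hdec, ← hsum, Finset.sum_mul, add_assoc, ← Finset.sum_add_distrib]
    refine add_le_add (mul_le_mul_of_nonneg_left hA (hp 0).le) (Finset.sum_le_sum fun i _ => ?_)
    have := mul_le_mul_of_nonneg_left (hB i) (hp i.succ).le
    linarith
  refine le_of_forall_pos_le_add fun ε hε => ?_
  have hne : ∀ P : Measure (EuclideanSpace ℝ (Fin q)),
      {r : ℝ | ∃ α : Finset (EuclideanSpace ℝ (Fin q)), α.Nonempty ∧ α.card ≤ k ∧
        r = ∫ x, Real.log (infDist x (↑α : Set (EuclideanSpace ℝ (Fin q)))) ∂P}.Nonempty :=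
    fun P => ⟨_, {0}, by simp, by simpa using hk1, rfl⟩
  obtain ⟨_, ⟨α, hα, hαk, rfl⟩, h1⟩ := exists_lt_of_csInf_lt (hne ν)
    (show hatE ν k < hatE ν k + ε by linarith)
  obtain ⟨_, ⟨β, hβ, hβk, rfl⟩, h2⟩ := exists_lt_of_csInf_lt (hne μ)
    (show hatE μ k < hatE μ k + ε by linarith)
  have h3 := key α β hα hαk hβ hβk
  have h4 := mul_le_mul_of_nonneg_left h1.le (hp 0).le
  have h5 := mul_le_mul_of_nonneg_left h2.le hp0
  linarith
end

section
/- Define d_k := (Σ_{σ∈Ω_k} m(σ) log t_σ)/(Σ_{σ∈Ω_k} m(σ) log s_σ) for k ≥ 1 and d₀ := (Σ_{i=1}^N t_i log t_i)/(Σ_{i=1}^N t_i log s_i). Then there exist a constant C₁ > 0 and k₀ ≥ 1 such that |d_k − d₀| ≤ C₁/k for all k ≥ k₀. -/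
/-- `p_σ = ∏_h p_{σ_h}` for a word `σ` over the alphabet `{1,…,N}`
(letter `i ∈ {1,…,N}` carries weight `p i`, where `p` is indexed by `{0,1,…,N}`). -/
def pword {N : ℕ} (p : Fin (N + 1) → ℝ) (σ : List (Fin N)) : ℝ :=
  (σ.map fun i => p i.succ).prod

/-- `a_σ = ∏_h a_{σ_h}` for a word `σ` over the alphabet `{1,…,N}`. -/
def aword {N : ℕ} (a : Fin N → ℝ) (σ : List (Fin N)) : ℝ := (σ.map a).prod

/-- `μ⁽¹⁾(σ) = Σ_{h=0}^{|σ|-1} p₀ p_{σ|_h} t_{σ^{(l)}_{-h}}`. -/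
def mu1 {N : ℕ} (p : Fin (N + 1) → ℝ) (t : Fin N → ℝ) (σ : List (Fin N)) : ℝ :=
  ∑ h ∈ Finset.range σ.length, p 0 * pword p (σ.take h) * aword t (σ.drop h)

/-- `m(σ) = μ⁽¹⁾(σ) + p_σ`. -/
def mWeight {N : ℕ} (p : Fin (N + 1) → ℝ) (t : Fin N → ℝ) (σ : List (Fin N)) : ℝ :=
  mu1 p t σ + pword p σ

theorem aux_sum {N : ℕ} (k : ℕ) (f : List (Fin N) → ℝ) :
    ∑ σ : Fin (k + 1) → Fin N, f (List.ofFn σ)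
      = ∑ i, ∑ σ : Fin k → Fin N, f (i :: List.ofFn σ) := by
  rw [← Fintype.sum_prod_type']
  symm
  refine Fintype.sum_equiv (Fin.consEquiv (fun _ => Fin N)) _ _ ?_
  rintro ⟨i, σ⟩
  simp [Fin.consEquiv, List.ofFn_cons]

theorem aux_m_cons {N : ℕ} (p : Fin (N + 1) → ℝ) (t : Fin N → ℝ) (i : Fin N)
    (l : List (Fin N)) :
    mWeight p t (i :: l) = p 0 * aword t (i :: l) + p i.succ * mWeight p t l := by
  unfold mWeight mu1
  rw [List.length_cons, Finset.sum_range_succ']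
  simp only [List.take_succ_cons, List.drop_succ_cons, List.take_zero, List.drop_zero]
  have h : ∀ l, pword p (i :: l) = p i.succ * pword p l := by intro l; simp [pword]
  simp only [h]
  have h0 : pword p [] = 1 := by simp [pword]
  rw [h0, mul_add, Finset.mul_sum]
  have : ∀ x ∈ Finset.range l.length,
      p 0 * (p i.succ * pword p (l.take x)) * aword t (l.drop x)
      = p i.succ * (p 0 * pword p (l.take x) * aword t (l.drop x)) := by
    intros; ring
  rw [Finset.sum_congr rfl this]
  ring

theorem aux_t1 {N : ℕ} (t : Fin N → ℝ) (htsum : ∑ i, t i = 1) (k : ℕ) :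
    ∑ σ : Fin k → Fin N, aword t (List.ofFn σ) = 1 := by
  induction k with
  | zero => simp [aword]
  | succ k ih =>
    rw [aux_sum]
    have h : ∀ i l, aword t (i :: l) = t i * aword t l := by intro i l; simp [aword]
    simp only [h, ← Finset.mul_sum, ih, mul_one, htsum]

theorem aux_m1 {N : ℕ} (p : Fin (N + 1) → ℝ) (hpsum : ∑ i, p i = 1)
    (t : Fin N → ℝ) (htsum : ∑ i, t i = 1) (k : ℕ) :
    ∑ σ : Fin k → Fin N, mWeight p t (List.ofFn σ) = 1 := by
  induction k with
  | zero => simp [mWeight, mu1, pword]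
  | succ k ih =>
    rw [Fin.sum_univ_succ] at hpsum
    have h := aux_t1 t htsum (k + 1)
    rw [aux_sum] at h ⊢
    simp only [aux_m_cons, Finset.sum_add_distrib, ← Finset.mul_sum, ih, mul_one, h]
    exact hpsum

theorem aux_log_s10 {N : ℕ} (a : Fin N → ℝ) (ha : ∀ i, 0 < a i) (i : Fin N) (l : List (Fin N)) :
    Real.log (aword a (i :: l)) = Real.log (a i) + Real.log (aword a l) := by
  have h : aword a (i :: l) = a i * aword a l := by simp [aword]
  have h2 : 0 < aword a l := by
    unfold aword
    apply List.prod_pos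
    intro x hx
    obtain ⟨j, _, rfl⟩ := List.mem_map.1 hx
    exact ha j
  rw [h, Real.log_mul (ha i).ne' h2.ne']

theorem aux_T {N : ℕ} (t : Fin N → ℝ) (htsum : ∑ i, t i = 1)
    (a : Fin N → ℝ) (ha : ∀ i, 0 < a i) (k : ℕ) :
    ∑ σ : Fin k → Fin N, aword t (List.ofFn σ) * Real.log (aword a (List.ofFn σ))
      = k * ∑ i, t i * Real.log (a i) := by
  induction k with
  | zero => simp [aword]
  | succ k ih =>
    rw [aux_sum k (fun l => aword t l * Real.log (aword a l))]
    have h : ∀ i l, aword t (i :: l) = t i * aword t l := by intro i l; simp [aword]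
    simp only [aux_log_s10 a ha, h, mul_add, Finset.sum_add_distrib]
    simp only [mul_right_comm (t _) _ (Real.log (a _))]
    simp only [mul_assoc (t _) (aword t _)]
    simp only [← Finset.mul_sum, ih, aux_t1 t htsum k, mul_one, ← Finset.sum_mul, htsum]
    push_cast; ring

theorem aux_M {N : ℕ} (p : Fin (N + 1) → ℝ) (hpsum : ∑ i, p i = 1)
    (t : Fin N → ℝ) (htsum : ∑ i, t i = 1)
    (a : Fin N → ℝ) (ha : ∀ i, 0 < a i) (k : ℕ) :
    ∑ σ : Fin (k + 1) → Fin N, mWeight p t (List.ofFn σ) * Real.log (aword a (List.ofFn σ))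
      = p 0 * ((k + 1) * ∑ i, t i * Real.log (a i)) + (∑ i : Fin N, p i.succ * Real.log (a i))
        + (1 - p 0) *
        ∑ σ : Fin k → Fin N, mWeight p t (List.ofFn σ) * Real.log (aword a (List.ofFn σ)) := by
  have hT := aux_T t htsum a ha (k + 1)
  rw [aux_sum k (fun l => aword t l * Real.log (aword a l))] at hT
  rw [aux_sum k (fun l => mWeight p t l * Real.log (aword a l))]
  simp only [aux_m_cons, add_mul, Finset.sum_add_distrib, mul_assoc (p 0), ← Finset.mul_sum, hT]
  simp only [aux_log_s10 a ha, mul_add, Finset.sum_add_distrib]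
  simp only [mul_right_comm (p _) _ (Real.log (a _))]
  simp only [mul_assoc (p _) (mWeight p t _)]
  have hpsum' := hpsum
  rw [Fin.sum_univ_succ] at hpsum
  have hq : ∑ i : Fin N, p i.succ = 1 - p 0 := by linarith
  simp only [← Finset.mul_sum, aux_m1 p hpsum' t htsum k, mul_one, ← Finset.sum_mul, hq]
  push_cast; ring

theorem aux_bd {N : ℕ} (p : Fin (N + 1) → ℝ) (hp : ∀ i, 0 < p i) (hpsum : ∑ i, p i = 1)
    (t : Fin N → ℝ) (htsum : ∑ i, t i = 1)
    (a : Fin N → ℝ) (ha : ∀ i, 0 < a i) :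
    ∃ B : ℝ, 0 ≤ B ∧ ∀ k : ℕ,
    |(∑ σ : Fin k → Fin N, mWeight p t (List.ofFn σ) * Real.log (aword a (List.ofFn σ)))
      - k * ∑ i, t i * Real.log (a i)| ≤ B := by
  have hM := aux_M p hpsum t htsum a ha
  set A := ∑ i, t i * Real.log (a i)
  set P := ∑ i : Fin N, p i.succ * Real.log (a i)
  have h0 := hp 0
  have h1 : p 0 ≤ 1 := by
    rw [← hpsum]
    exact Finset.single_le_sum (fun i _ => (hp i).le) (Finset.mem_univ 0)
  refine ⟨(|P| + |A|) / p 0, by positivity, fun k => ?_⟩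
  induction k with
  | zero => simp [aword]; positivity
  | succ k ih =>
    rw [hM k]
    generalize (∑ σ : Fin k → Fin N, mWeight p t (List.ofFn σ) *
      Real.log (aword a (List.ofFn σ))) = M at ih ⊢
    have hB : (|P| + |A|) / p 0 * p 0 = |P| + |A| := by field_simp
    set B := (|P| + |A|) / p 0
    have e : p 0 * ((k + 1) * A) + P + (1 - p 0) * M - ((k + 1 : ℕ) : ℝ) * A
      = P + (1 - p 0) * (M - k * A) - (1 - p 0) * A := by push_cast; ring
    rw [e]
    obtain ⟨i1, i2⟩ := abs_le.1 ih
    have q : 0 ≤ 1 - p 0 := by linarith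
    have j1 := mul_le_mul_of_nonneg_left i1 q
    have j2 := mul_le_mul_of_nonneg_left i2 q
    have j3 := mul_le_mul_of_nonneg_left (le_abs_self A) q
    have j4 := mul_le_mul_of_nonneg_left (neg_abs_le A) q
    have j5 : 0 ≤ p 0 * |A| := by positivity
    have j6 := le_abs_self P
    have j7 := neg_abs_le P
    rw [abs_le]
    constructor <;> nlinarith

theorem stmt10 (N : ℕ) (hN : 2 ≤ N)
    (p : Fin (N + 1) → ℝ) (hp : ∀ i, 0 < p i) (hpsum : ∑ i, p i = 1)
    (t : Fin N → ℝ) (ht : ∀ i, 0 < t i) (htsum : ∑ i, t i = 1)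
    (s : Fin N → ℝ) (hs : ∀ i, s i ∈ Set.Ioo (0 : ℝ) 1)
    (d : ℕ → ℝ)
    (hd : ∀ k : ℕ, 1 ≤ k → d k =
      (∑ σ : Fin k → Fin N, mWeight p t (List.ofFn σ) * Real.log (aword t (List.ofFn σ))) /
      (∑ σ : Fin k → Fin N, mWeight p t (List.ofFn σ) * Real.log (aword s (List.ofFn σ))))
    (d₀ : ℝ) (hd₀ : d₀ = (∑ i, t i * Real.log (t i)) / (∑ i, t i * Real.log (s i))) :
    ∃ C₁ : ℝ, 0 < C₁ ∧ ∃ k₀ : ℕ, 1 ≤ k₀ ∧ ∀ k : ℕ, k₀ ≤ k →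
      |d k - d₀| ≤ C₁ / k := by
  obtain ⟨B, hB0, hB⟩ := aux_bd p hp hpsum t htsum t ht
  obtain ⟨B', hB0', hB'⟩ := aux_bd p hp hpsum t htsum s (fun i => (hs i).1)
  have hneg : ∑ i, t i * Real.log (s i) < 0 := by
    apply Finset.sum_neg
    · intro i _
      exact mul_neg_of_pos_of_neg (ht i) (Real.log_neg (hs i).1 (hs i).2)
    · exact ⟨⟨0, by omega⟩, Finset.mem_univ _⟩
  subst hd₀
  set A := ∑ i, t i * Real.log (t i)
  set S := ∑ i, t i * Real.log (s i)
  obtain ⟨n, hn⟩ := exists_nat_gt (2 * B' / (-S))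
  have hS : 0 < -S := by linarith
  refine ⟨2 * (B * (-S) + B' * |A|) / S ^ 2 + 1, by positivity, n + 1, by omega, ?_⟩
  intro k hk
  rw [hd k (by omega)]
  have b := hB k
  have b' := hB' k
  generalize (∑ σ : Fin k → Fin N, mWeight p t (List.ofFn σ) *
      Real.log (aword t (List.ofFn σ))) = X at b ⊢
  generalize (∑ σ : Fin k → Fin N, mWeight p t (List.ofFn σ) *
      Real.log (aword s (List.ofFn σ))) = Y at b' ⊢
  have hnk : (n : ℝ) + 1 ≤ k := by exact_mod_cast hk
  have hk0 : (0 : ℝ) < k := by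
    have : (0:ℝ) ≤ n := n.cast_nonneg
    linarith
  rw [div_lt_iff₀ hS] at hn
  have hY : k * (-S) / 2 ≤ -Y := by
    have := (abs_le.1 b').2
    nlinarith
  have hkS : 0 < k * (-S) / 2 := by positivity
  have hY0 : 0 < -Y := by linarith
  have e : X / Y - A / S = ((X - k * A) * S - (Y - k * S) * A) / ((-S) * (-Y)) := by
    have : Y ≠ 0 := by intro h; linarith
    have : S ≠ 0 := hneg.ne
    field_simp
    ring
  rw [e, abs_div, abs_of_pos (mul_pos hS hY0)]
  have hnum : |(X - k * A) * S - (Y - k * S) * A| ≤ B * (-S) + B' * |A| := by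
    refine (abs_sub _ _).trans ?_
    rw [abs_mul, abs_mul, abs_of_neg hneg]
    gcongr
  calc _ ≤ (B * (-S) + B' * |A|) / ((-S) * (k * (-S) / 2)) := by gcongr
    _ = (2 * (B * (-S) + B' * |A|) / S ^ 2) / k := by
      have : S ≠ 0 := hneg.ne
      field_simp
    _ ≤ _ := by gcongr; linarith
end

section
/- For every σ ∈ Ω* and every h ≥ 1, Σ_{ω∈Γ(σ,h)} μ⁽¹⁾(ω) = μ⁽¹⁾(σ) + p_σ (1 − p₀)(1 − (1 − p₀)^{h−1}) + p₀ p_σ. -/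
theorem mu1_snoc {N : ℕ} (p : Fin (N + 1) → ℝ) (t : Fin N → ℝ) (σ : List (Fin N)) (i : Fin N) :
    mu1 p t (σ ++ [i]) = t i * (mu1 p t σ + p 0 * pword p σ) := by
  unfold mu1
  rw [List.length_append, List.length_singleton, Finset.sum_range_succ, mul_add, Finset.mul_sum]
  congr 1
  · refine Finset.sum_congr rfl fun h hh => ?_
    have hle : h ≤ σ.length := (Finset.mem_range.1 hh).le
    rw [List.take_append_of_le_length hle, List.drop_append_of_le_length hle]
    simp only [aword, List.map_append, List.prod_append, List.map_cons, List.map_nil,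
      List.prod_cons, List.prod_nil]
    ring
  · simp [aword]
    ring

theorem sum_aux {N : ℕ} (p : Fin (N + 1) → ℝ) (hpsum : ∑ i, p i = 1)
    (t : Fin N → ℝ) (htsum : ∑ i, t i = 1) (h : ℕ) : ∀ σ : List (Fin N),
    ∑ ω : Fin h → Fin N, mu1 p t (σ ++ List.ofFn ω) =
      mu1 p t σ + pword p σ * (1 - (1 - p 0) ^ h) := by
  have hs : ∑ i : Fin N, p i.succ = 1 - p 0 := by
    rw [Fin.sum_univ_succ] at hpsum
    linarith
  induction h with
  | zero => intro σ; simp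
  | succ h ih =>
    intro σ
    rw [← (Fin.consEquiv (fun _ : Fin (h + 1) => Fin N)).sum_comp, Fintype.sum_prod_type]
    have key : ∀ i : Fin N, ∑ ω : Fin h → Fin N,
        mu1 p t (σ ++ List.ofFn ((Fin.consEquiv (fun _ : Fin (h + 1) => Fin N)) (i, ω))) =
        t i * (mu1 p t σ + p 0 * pword p σ) +
          p i.succ * (pword p σ * (1 - (1 - p 0) ^ h)) := by
      intro i
      have h1 := ih (σ ++ [i])
      rw [mu1_snoc] at h1
      have h2 : pword p (σ ++ [i]) = pword p σ * p i.succ := by simp [pword]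
      rw [h2] at h1
      have h3 : ∀ ω : Fin h → Fin N,
          σ ++ List.ofFn ((Fin.consEquiv (fun _ : Fin (h + 1) => Fin N)) (i, ω)) =
            (σ ++ [i]) ++ List.ofFn ω := by
        intro ω
        simp [Fin.consEquiv, List.ofFn_succ]
      simp only [h3]
      rw [h1]
      ring
    rw [Finset.sum_congr rfl fun i _ => key i, Finset.sum_add_distrib, ← Finset.sum_mul,
      ← Finset.sum_mul, hs, htsum]
    ring

/-- Summing `μ⁽¹⁾` over `Γ(σ,h)`, the set of descendants `τ ⪰ σ` with `|τ| = |σ| + h`,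
i.e. over all words `σ ∗ ω` with `ω ∈ Ω_h`. -/
theorem stmt11 (N : ℕ) (hN : 2 ≤ N)
    (p : Fin (N + 1) → ℝ) (hp : ∀ i, 0 < p i) (hpsum : ∑ i, p i = 1)
    (t : Fin N → ℝ) (ht : ∀ i, 0 < t i) (htsum : ∑ i, t i = 1) :
    ∀ σ : List (Fin N), σ ≠ [] → ∀ h : ℕ, 1 ≤ h →
      ∑ ω : Fin h → Fin N, mu1 p t (σ ++ List.ofFn ω) =
        mu1 p t σ + pword p σ * (1 - p 0) * (1 - (1 - p 0) ^ (h - 1)) + p 0 * pword p σ := by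
  intro σ _ h hh
  obtain ⟨k, rfl⟩ : ∃ k, h = k + 1 := ⟨h - 1, by omega⟩
  rw [sum_aux p hpsum t htsum, Nat.add_sub_cancel]
  ring
end

section
/- For every finite maximal antichain Γ ⊂ Ω*, Σ_{σ∈Γ} p_σ ≤ (1 − p₀)^{l(Γ)}, where l(Γ) := min_{σ∈Γ} |σ|. -/
theorem aux13 {N : ℕ} (w : Fin N → ℝ) (hw : ∀ i, 0 ≤ w i) (hq : ∑ i, w i ≤ 1) (M : ℕ) :
    ∀ (l : ℕ) (Γ : Finset (List (Fin N))), (∀ σ ∈ Γ, l ≤ σ.length) → (∀ σ ∈ Γ, σ.length < M) →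
    (∀ σ ∈ Γ, ∀ τ ∈ Γ, σ ≠ τ → ¬ σ <+: τ) →
    ∑ σ ∈ Γ, (σ.map w).prod ≤ (∑ i, w i) ^ l := by
  have hq0 : 0 ≤ ∑ i, w i := Finset.sum_nonneg fun i _ => hw i
  induction M with
  | zero =>
    intro l Γ _ h2 _
    have : Γ = ∅ := Finset.eq_empty_of_forall_notMem fun σ h => by simpa using h2 σ h
    subst this
    simpa using pow_nonneg hq0 l
  | succ M ih =>
    intro l Γ h1 h2 h3
    by_cases hnil : [] ∈ Γ
    · have hl : l = 0 := by simpa using h1 _ hnil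
      have : Γ = {[]} := by
        refine Finset.eq_singleton_iff_unique_mem.2 ⟨hnil, fun σ h => ?_⟩
        by_contra hne
        exact h3 _ hnil σ h (Ne.symm hne) (List.nil_prefix)
      subst this
      simp [hl]
    · let G : Fin N → Finset (List (Fin N)) := fun i =>
        Γ.preimage (fun τ => i :: τ) (fun a _ b _ h => by simpa using h)
      have hG : ∀ i τ, τ ∈ G i ↔ i :: τ ∈ Γ := fun i τ => Finset.mem_preimage
      have key : ∑ σ ∈ Γ, (σ.map w).prod = ∑ i, ∑ τ ∈ G i, w i * (τ.map w).prod := by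
        rw [Finset.sum_sigma']
        symm
        refine Finset.sum_bij (fun x _ => x.1 :: x.2) ?_ ?_ ?_ ?_
        · rintro ⟨i, τ⟩ h
          simpa [hG] using h
        · rintro ⟨i, τ⟩ _ ⟨j, υ⟩ _ h
          simp at h
          obtain ⟨rfl, rfl⟩ := h
          rfl
        · intro σ h
          cases σ with
          | nil => exact absurd h hnil
          | cons i τ => exact ⟨⟨i, τ⟩, by simpa [hG] using h, rfl⟩
        · rintro ⟨i, τ⟩ _
          simp
      have hb : ∀ i, ∑ τ ∈ G i, w i * (τ.map w).prod ≤ w i * (∑ i, w i) ^ (l - 1) := by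
        intro i
        rw [← Finset.mul_sum]
        refine mul_le_mul_of_nonneg_left (ih (l - 1) (G i) ?_ ?_ ?_) (hw i)
        · intro σ h
          have := h1 _ ((hG i σ).1 h)
          simp at this
          omega
        · intro σ h
          have := h2 _ ((hG i σ).1 h)
          simp at this
          omega
        · intro σ h τ h' hne hpre
          exact h3 _ ((hG i σ).1 h) _ ((hG i τ).1 h') (by simpa using hne)
            (by simpa [List.cons_prefix_cons] using hpre)
      rw [key]
      refine (Finset.sum_le_sum fun i _ => hb i).trans ?_
      rw [← Finset.sum_mul, ← pow_succ']
      exact pow_le_pow_of_le_one hq0 hq (by omega)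

theorem stmt13 (N : ℕ) (hN : 1 ≤ N)
    (p : Fin (N + 1) → ℝ) (hp : ∀ i, 0 < p i) (hpsum : ∑ i, p i = 1)
    (Γ : Finset (List (Fin N)))
    (hΓne : ∀ σ ∈ Γ, σ ≠ [])
    (hanti : ∀ σ ∈ Γ, ∀ τ ∈ Γ, σ ≠ τ → ¬ σ <+: τ ∧ ¬ τ <+: σ)
    (hmax : ∀ x : ℕ → Fin N, ∃ σ ∈ Γ, σ = List.ofFn fun i : Fin σ.length => x i) :
    ∑ σ ∈ Γ, pword p σ ≤ (1 - p 0) ^ sInf {n : ℕ | ∃ σ ∈ Γ, σ.length = n} := by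
  rw [Fin.sum_univ_succ] at hpsum
  have h0 := hp 0
  have e : 1 - p 0 = ∑ i : Fin N, p i.succ := by linarith
  rw [e]
  refine aux13 (fun i => p i.succ) (fun i => (hp _).le) (by linarith)
    (Γ.sup List.length + 1) _ Γ ?_ ?_ ?_
  · intro σ h
    exact Nat.sInf_le ⟨σ, h, rfl⟩
  · intro σ h
    exact Nat.lt_succ_of_le (Finset.le_sup (f := List.length) h)
  · intro σ h τ h' hne
    exact (hanti σ h τ h' hne).1
end

section
/- There exist a constant C₃ > 0 and j₀ ≥ 1 such that for all j ≥ j₀, |Σ_{σ∈Λ_j} m(σ) log s_σ| ≥ C₃ j. -/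
/-- The finite maximal antichain `Λ_j = {σ ∈ Ω^* : t_{σ⁻} ≥ t̲^j > t_σ}`,
where `t̲ = min_i t_i`. -/
def Lam {N : ℕ} (t : Fin N → ℝ) (j : ℕ) : Set (List (Fin N)) :=
  {σ | σ ≠ [] ∧ (⨅ i, t i) ^ j ≤ aword t σ.dropLast ∧ aword t σ < (⨅ i, t i) ^ j}

lemma aword_append {N : ℕ} (a : Fin N → ℝ) (σ : List (Fin N)) (i : Fin N) :
    aword a (σ ++ [i]) = aword a σ * a i := by simp [aword]

lemma pword_append {N : ℕ} (p : Fin (N + 1) → ℝ) (σ : List (Fin N)) (i : Fin N) :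
    pword p (σ ++ [i]) = pword p σ * p i.succ := by simp [pword]

lemma mu1_append {N : ℕ} (p : Fin (N + 1) → ℝ) (t : Fin N → ℝ) (σ : List (Fin N)) (i : Fin N) :
    mu1 p t (σ ++ [i]) = mu1 p t σ * t i + p 0 * pword p σ * t i := by
  unfold mu1
  rw [List.length_append, List.length_singleton, Finset.sum_range_succ, Finset.sum_mul]
  congr 1
  · apply Finset.sum_congr rfl
    intro h hh
    have hh' : h ≤ σ.length := (Finset.mem_range.mp hh).le
    rw [List.take_append_of_le_length hh', List.drop_append_of_le_length hh', aword_append]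
    ring
  · simp [aword]

lemma mWeight_sum {N : ℕ} (p : Fin (N + 1) → ℝ) (hpsum : ∑ i, p i = 1)
    (t : Fin N → ℝ) (htsum : ∑ i, t i = 1) (σ : List (Fin N)) :
    ∑ i, mWeight p t (σ ++ [i]) = mWeight p t σ := by
  unfold mWeight
  simp only [mu1_append, pword_append, Finset.sum_add_distrib, ← Finset.mul_sum, htsum]
  rw [Fin.sum_univ_succ] at hpsum
  have : ∑ i : Fin N, p i.succ = 1 - p 0 := by linarith
  rw [this]; ring

lemma aword_pos {N : ℕ} (a : Fin N → ℝ) (ha : ∀ i, 0 < a i) (σ : List (Fin N)) :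
    0 < aword a σ := by
  apply List.prod_pos
  intro x hx
  obtain ⟨i, -, rfl⟩ := List.mem_map.mp hx
  exact ha i

lemma mWeight_nonneg {N : ℕ} (p : Fin (N + 1) → ℝ) (hp : ∀ i, 0 < p i)
    (t : Fin N → ℝ) (ht : ∀ i, 0 < t i) (σ : List (Fin N)) : 0 ≤ mWeight p t σ := by
  have h1 : ∀ τ, 0 < pword p τ := fun τ => aword_pos (fun i => p i.succ) (fun i => hp _) τ
  apply add_nonneg _ (h1 σ).le
  apply Finset.sum_nonneg
  intro h _
  exact mul_nonneg (mul_nonneg (hp 0).le (h1 _).le) (aword_pos t ht _).le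

lemma aword_le_pow {N : ℕ} (a : Fin N → ℝ) (ha : ∀ i, 0 < a i) (r : ℝ) (hr : ∀ i, a i ≤ r)
    (σ : List (Fin N)) : aword a σ ≤ r ^ σ.length := by
  induction σ using List.reverseRecOn with
  | nil => simp [aword]
  | append_singleton σ i ih =>
    rw [aword_append, List.length_append, List.length_singleton, pow_succ]
    exact mul_le_mul ih (hr i) (ha i).le ((aword_pos a ha σ).le.trans ih)

lemma pow_le_aword {N : ℕ} (a : Fin N → ℝ) (r : ℝ) (h0 : 0 ≤ r) (hr : ∀ i, r ≤ a i)
    (σ : List (Fin N)) : r ^ σ.length ≤ aword a σ := by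
  induction σ using List.reverseRecOn with
  | nil => simp [aword]
  | append_singleton σ i ih =>
    rw [aword_append, List.length_append, List.length_singleton, pow_succ]
    exact mul_le_mul ih (hr i) h0 ((pow_nonneg h0 _).trans ih)

lemma log_aword {N : ℕ} (s : Fin N → ℝ) (hs : ∀ i, 0 < s i) (c : ℝ)
    (hc : ∀ i, c ≤ -Real.log (s i)) (σ : List (Fin N)) :
    c * σ.length ≤ -Real.log (aword s σ) := by
  induction σ using List.reverseRecOn with
  | nil => simp [aword]
  | append_singleton σ i ih =>
    rw [aword_append, List.length_append, List.length_singleton,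
      Real.log_mul (aword_pos s hs σ).ne' (hs i).ne']
    push_cast
    linarith [hc i]

lemma cut_exists {N : ℕ} (f : List (Fin N) → ℝ) (hf : ∀ σ, ∑ i, f (σ ++ [i]) = f σ)
    (t : Fin N → ℝ) (ε : ℝ) (hε : ε ≤ 1) (n : ℕ) :
    ∃ A L : Finset (List (Fin N)),
      (∀ σ ∈ A, σ.length = n ∧ ε ≤ aword t σ) ∧
      (∀ σ ∈ L, σ.length ≤ n ∧ σ ≠ [] ∧ ε ≤ aword t σ.dropLast ∧ aword t σ < ε) ∧
      ∑ σ ∈ A, f σ + ∑ σ ∈ L, f σ = f [] := by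
  classical
  induction n with
  | zero => exact ⟨{[]}, ∅, by simpa [aword] using hε, by simp, by simp⟩
  | succ n ih =>
    obtain ⟨A, L, hA, hL, hs⟩ := ih
    let B := (A ×ˢ (Finset.univ : Finset (Fin N))).image (fun x => x.1 ++ [x.2])
    have hB : ∀ σ ∈ B, ∃ τ ∈ A, ∃ i, τ ++ [i] = σ := by
      intro σ hσ
      obtain ⟨x, hx, rfl⟩ := Finset.mem_image.mp hσ
      exact ⟨x.1, (Finset.mem_product.mp hx).1, x.2, rfl⟩
    have hBs : ∑ σ ∈ B, f σ = ∑ σ ∈ A, f σ := by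
      rw [Finset.sum_image, Finset.sum_product]
      · exact Finset.sum_congr rfl fun σ _ => hf σ
      · rintro ⟨a, b⟩ _ ⟨c, d⟩ _ h
        have := List.append_inj' h rfl
        simp_all
    refine ⟨B.filter (fun σ => ε ≤ aword t σ), L ∪ B.filter (fun σ => ¬ ε ≤ aword t σ), ?_, ?_, ?_⟩
    · intro σ hσ
      obtain ⟨h1, h2⟩ := Finset.mem_filter.mp hσ
      obtain ⟨τ, hτ, i, rfl⟩ := hB σ h1
      exact ⟨by simp [(hA τ hτ).1], h2⟩
    · intro σ hσ
      rcases Finset.mem_union.mp hσ with h | h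
      · exact ⟨(hL σ h).1.trans (Nat.le_succ n), (hL σ h).2⟩
      · obtain ⟨h1, h2⟩ := Finset.mem_filter.mp h
        obtain ⟨τ, hτ, i, rfl⟩ := hB σ h1
        exact ⟨by simp [(hA τ hτ).1], by simp, by simpa using (hA τ hτ).2, not_le.mp h2⟩
    · rw [Finset.sum_union]
      · rw [← hs, ← hBs, ← Finset.sum_filter_add_sum_filter_not B (fun σ => ε ≤ aword t σ)]
        ring
      · rw [Finset.disjoint_left]
        intro σ h1 h2
        obtain ⟨τ, hτ, i, rfl⟩ := hB σ (Finset.mem_filter.mp h2).1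
        have := (hL _ h1).1
        simp [(hA τ hτ).1] at this

theorem stmt14 (N : ℕ) (hN : 2 ≤ N)
    (p : Fin (N + 1) → ℝ) (hp : ∀ i, 0 < p i) (hpsum : ∑ i, p i = 1)
    (t : Fin N → ℝ) (ht : ∀ i, 0 < t i) (htsum : ∑ i, t i = 1)
    (s : Fin N → ℝ) (hs : ∀ i, s i ∈ Set.Ioo (0 : ℝ) 1) :
    ∃ C₃ : ℝ, 0 < C₃ ∧ ∃ j₀ : ℕ, 1 ≤ j₀ ∧ ∀ j : ℕ, j₀ ≤ j →
      C₃ * j ≤ |∑ᶠ σ ∈ Lam t j, mWeight p t σ * Real.log (aword s σ)| := by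
  haveI : Nonempty (Fin N) := ⟨⟨0, by omega⟩⟩
  haveI : Nontrivial (Fin N) := Fin.nontrivial_iff_two_le.mpr hN
  have ht1 : ∀ i, t i < 1 := by
    intro i
    obtain ⟨k, hk⟩ := exists_ne i
    rw [← htsum]
    exact Finset.single_lt_sum hk (Finset.mem_univ i) (Finset.mem_univ k) (ht k)
      (fun k _ _ => (ht k).le)
  obtain ⟨i0, hi0⟩ := Finite.exists_max t
  obtain ⟨i1, hi1⟩ := Finite.exists_min (fun i => -Real.log (s i))
  have hc : 0 < -Real.log (s i1) := neg_pos.mpr (Real.log_neg (hs i1).1 (hs i1).2)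
  set c := -Real.log (s i1) with hcdef
  refine ⟨c, hc, 1, le_rfl, fun j hj => ?_⟩
  obtain ⟨i2, hi2⟩ := exists_eq_ciInf_of_finite (f := t)
  have hle : ∀ i, (⨅ i, t i) ≤ t i := fun i => ciInf_le (Set.finite_range t).bddBelow i
  have hpos : 0 < ⨅ i, t i := hi2 ▸ ht i2
  have hlt1 : (⨅ i, t i) < 1 := hi2 ▸ ht1 i2
  set u := ⨅ i, t i with hu
  have hεpos : 0 < u ^ j := pow_pos hpos j
  have hε1 : u ^ j ≤ 1 := pow_le_one₀ hpos.le hlt1.le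
  obtain ⟨n, hn⟩ := exists_pow_lt_of_lt_one hεpos (ht1 i0)
  have hlong : ∀ σ : List (Fin N), n ≤ σ.length → aword t σ < u ^ j := fun σ hσ =>
    ((aword_le_pow t ht _ hi0 σ).trans
      (pow_le_pow_of_le_one (ht i0).le (ht1 i0).le hσ)).trans_lt hn
  have hfin : (Lam t j).Finite := by
    apply (List.finite_length_lt (Fin N) (n + 1)).subset
    intro σ hσ
    by_contra hcon
    have hcon' : n + 1 ≤ σ.length := not_lt.mp hcon
    have := hlong σ.dropLast (by rw [List.length_dropLast]; omega)
    exact absurd hσ.2.1 (not_le.mpr this)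
  have hlen : ∀ σ ∈ Lam t j, j ≤ σ.length := by
    intro σ hσ
    by_contra hcon
    have h1 := (pow_le_pow_of_le_one hpos.le hlt1.le (not_le.mp hcon).le).trans
      (pow_le_aword t u hpos.le hle σ)
    exact absurd hσ.2.2 (not_lt.mpr h1)
  obtain ⟨A, L, hA, hL, hsum⟩ :=
    cut_exists (mWeight p t) (mWeight_sum p hpsum t htsum) t (u ^ j) hε1 n
  have hAe : A = ∅ := by
    apply Finset.eq_empty_of_forall_notMem
    intro σ hσ
    exact absurd (hA σ hσ).2 (not_le.mpr (hlong σ (hA σ hσ).1.ge))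
  have hsumL : ∑ σ ∈ L, mWeight p t σ = 1 := by
    simpa [hAe, mWeight, mu1, pword] using hsum
  have hLsub : L ⊆ hfin.toFinset := by
    intro σ hσ
    rw [Set.Finite.mem_toFinset]
    exact (hL σ hσ).2
  rw [finsum_mem_eq_finite_toFinset_sum _ hfin]
  refine le_trans ?_ (neg_le_abs _)
  rw [← Finset.sum_neg_distrib]
  have hm := mWeight_nonneg p hp t ht
  have hlog : ∀ σ : List (Fin N), c * σ.length ≤ -Real.log (aword s σ) :=
    log_aword s (fun i => (hs i).1) c hi1
  calc c * j = ∑ σ ∈ L, mWeight p t σ * (c * j) := by rw [← Finset.sum_mul, hsumL, one_mul]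
    _ ≤ ∑ σ ∈ hfin.toFinset, mWeight p t σ * (c * j) :=
      Finset.sum_le_sum_of_subset_of_nonneg hLsub
        (fun σ _ _ => mul_nonneg (hm σ) (by positivity))
    _ ≤ _ := by
      apply Finset.sum_le_sum
      intro σ hσ
      rw [← mul_neg]
      apply mul_le_mul_of_nonneg_left _ (hm σ)
      refine le_trans ?_ (hlog σ)
      have := hlen σ (hfin.mem_toFinset.mp hσ)
      gcongr
end
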